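/- Let n,N ≥ 2, let Ω ⊆ ℝⁿ be an open, convex, bounded set with C² boundary, and let F : Ω × ℝ^{Nn²}_s → ℝ^N be a Carathéodory map satisfying the K-condition with data (**A**, α, β, γ), where **A** satisfies the structural hypothesis (SH). Then for any u, v ∈ (H² ∩ H¹₀)(Ω)^N one has ‖α(·)(F(·,D²u) − F(·,D²v)) − **A**:(D²u − D²v)‖_{L²(Ω)} ≤ (β+γ) ‖**A**:(D²u − D²v)‖_{L²(Ω)}; that is, the operator u ↦ α(·)F(·,D²u) is near the linear operator u ↦ **A**:D²u in Campanato's sense, with nearness constant β+γ < 1. -/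

import Mathlib

open MeasureTheory Filter Topology
open scoped BigOperators

noncomputable section

/-- `Euc n` is the Euclidean space `ℝⁿ`. -/
abbrev Euc (n : ℕ) : Type := EuclideanSpace ℝ (Fin n)

/-- Squared Euclidean norm of a finite vector. -/
def vsq {m : ℕ} (v : Fin m → ℝ) : ℝ := ∑ i, (v i) ^ 2

/-- Squared Euclidean norm of a third order tensor `X ∈ ℝ^{N×n×n}`. -/
def tsq {N n : ℕ} (X : Fin N → Fin n → Fin n → ℝ) : ℝ :=
  ∑ α, ∑ i, ∑ j, (X α i j) ^ 2

/-- First partial derivative `D_i f`. -/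
def pder {n : ℕ} (f : Euc n → ℝ) (i : Fin n) (x : Euc n) : ℝ :=
  fderiv ℝ f x (EuclideanSpace.single i 1)

/-- Second partial derivative `D²_{ij} f`. -/
def pder2 {n : ℕ} (f : Euc n → ℝ) (i j : Fin n) (x : Euc n) : ℝ :=
  pder (fun y => pder f j y) i x

/-- Hessian tensor `D²u(x) ∈ ℝ^{Nn²}` of a vector valued map `u : ℝⁿ → ℝ^N`. -/
def Hess {n N : ℕ} (u : Euc n → Fin N → ℝ) (x : Euc n) : Fin N → Fin n → Fin n → ℝ :=
  fun α i j => pder2 (fun y => u y α) i j x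

/-- The contraction `(𝐀:X)_α = Σ_{i,β,j} A_{αiβj} X_{βij}`. -/
def AC {n N : ℕ} (A : Fin N → Fin n → Fin N → Fin n → ℝ)
    (X : Fin N → Fin n → Fin n → ℝ) : Fin N → ℝ :=
  fun α => ∑ i, ∑ β, ∑ j, A α i β j * X β i j

/-- The quadratic form `𝐀 : η⊗a⊗η⊗a = Σ A_{αiβj} η_α a_i η_β a_j`. -/
def QF {n N : ℕ} (A : Fin N → Fin n → Fin N → Fin n → ℝ)
    (η : Fin N → ℝ) (a : Fin n → ℝ) : ℝ :=
  ∑ α, ∑ i, ∑ β, ∑ j, A α i β j * η α * a i * η β * a j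

/-- Symmetry `A_{αiβj} = A_{βjαi}` of a fourth order tensor (i.e. `𝐀 ∈ ℝ^{Nn×Nn}_s`). -/
def SymT {n N : ℕ} (A : Fin N → Fin n → Fin N → Fin n → ℝ) : Prop :=
  ∀ α i β j, A α i β j = A β j α i

/-- Symmetry `X_{αij} = X_{αji}`, i.e. `X ∈ ℝ^{Nn²}_s`. -/
def SymX {n N : ℕ} (X : Fin N → Fin n → Fin n → ℝ) : Prop :=
  ∀ α i j, X α i j = X α j i

/-- `𝐀` is rank-one positive: `𝐀:η⊗a⊗η⊗a ≥ ν |η|²|a|²` for some `ν > 0`. -/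
def RankOnePos {n N : ℕ} (A : Fin N → Fin n → Fin N → Fin n → ℝ) : Prop :=
  ∃ ν > (0:ℝ), ∀ (η : Fin N → ℝ) (a : Fin n → ℝ), ν * vsq η * vsq a ≤ QF A η a

/-- The ellipticity constant `ν(𝐀) = min_{|η|=|a|=1} 𝐀:η⊗a⊗η⊗a`. -/
def nuA {n N : ℕ} (A : Fin N → Fin n → Fin N → Fin n → ℝ) : ℝ :=
  sInf {v | ∃ (η : Fin N → ℝ) (a : Fin n → ℝ), vsq η = 1 ∧ vsq a = 1 ∧ v = QF A η a}

/-- The smallest eigenvalue `λ₁(M) = min_{|a|=1} M:a⊗a` of a symmetric matrix. -/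
def lam1 {m : ℕ} (M : Matrix (Fin m) (Fin m) ℝ) : ℝ :=
  sInf {v | ∃ a : Fin m → ℝ, vsq a = 1 ∧ v = ∑ i, ∑ j, M i j * a i * a j}

/-- The structural hypothesis (SH) for `𝐀` with the decomposition data
`𝐀 = Σ_γ B^γ ⊗ A^γ` given explicitly. -/
def SHdata {n N : ℕ} (A : Fin N → Fin n → Fin N → Fin n → ℝ)
    (B : Fin N → Matrix (Fin N) (Fin N) ℝ)
    (M : Fin N → Matrix (Fin n) (Fin n) ℝ) : Prop :=
  (∀ γ, (B γ).IsSymm) ∧ (∀ γ, (M γ).IsSymm) ∧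
  (∀ α i β j, A α i β j = ∑ γ, B γ α β * M γ i j) ∧
  (∀ γ δ, γ ≠ δ → ∀ y z : Fin N → ℝ, ∑ α, (B γ).mulVec y α * (B δ).mulVec z α = 0) ∧
  (∑ γ, B γ).PosDef ∧ (∀ γ, (M γ).PosDef) ∧
  (∃ a : Fin n → ℝ, a ≠ 0 ∧ ∀ γ, (M γ).mulVec a = lam1 (M γ) • a)

/-- The structural hypothesis (SH). -/
def SH {n N : ℕ} (A : Fin N → Fin n → Fin N → Fin n → ℝ) : Prop :=
  ∃ B M, SHdata A B M

/-- `Ω` is a (bounded) domain with `C²` boundary, encoded via a `C²` defining function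
with nonvanishing gradient on the boundary. -/
def IsC2Domain {n : ℕ} (Ω : Set (Euc n)) : Prop :=
  ∃ ρ : Euc n → ℝ, ContDiff ℝ 2 ρ ∧ Ω = {x | ρ x < 0} ∧
    ∀ x ∈ frontier Ω, fderiv ℝ ρ x ≠ 0

/-- `F : Ω × ℝ^{Nn²}_s → ℝ^N` is a Carathéodory map: measurable in `x`, continuous in `X`. -/
def Caratheodory {n N : ℕ} (Ω : Set (Euc n))
    (F : Euc n → (Fin N → Fin n → Fin n → ℝ) → Fin N → ℝ) : Prop :=
  (∀ X, Measurable fun x => F x X) ∧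
  (∀ᵐ x ∂(volume.restrict Ω), Continuous fun X => F x X)

/-- The K-condition (ellipticity) for `F` with data `(𝐀, α, β, γ)`. -/
def KCond {n N : ℕ} (Ω : Set (Euc n))
    (F : Euc n → (Fin N → Fin n → Fin n → ℝ) → Fin N → ℝ)
    (A : Fin N → Fin n → Fin N → Fin n → ℝ)
    (al : Euc n → ℝ) (β γ : ℝ) : Prop :=
  SymT A ∧ RankOnePos A ∧ Measurable al ∧
  (∃ C : ℝ, ∀ᵐ x ∂(volume.restrict Ω), |al x| ≤ C) ∧
  (∀ᵐ x ∂(volume.restrict Ω), 0 < al x) ∧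
  (∃ C : ℝ, ∀ᵐ x ∂(volume.restrict Ω), |1 / al x| ≤ C) ∧
  0 < β ∧ 0 < γ ∧ β + γ < 1 ∧
  (∀ᵐ x ∂(volume.restrict Ω), ∀ X Z : Fin N → Fin n → Fin n → ℝ, SymX X → SymX Z →
    Real.sqrt (vsq fun α => AC A Z α - al x * (F x (X + Z) α - F x X α)) ≤
      β * nuA A * Real.sqrt (tsq Z) + γ * Real.sqrt (vsq (AC A Z)))

/-- Membership `u ∈ (H² ∩ H¹₀)(Ω)^N` (as a strong/classical object): twice
differentiable on `Ω`, with `u`, `Du`, `D²u` square integrable on `Ω`, and zero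
boundary trace. -/
structure IsH2H10 {n N : ℕ} (Ω : Set (Euc n)) (u : Euc n → Fin N → ℝ) : Prop where
  contDiffOn : ∀ α, ContDiffOn ℝ 2 (fun x => u x α) Ω
  memL2 : IntegrableOn (fun x => vsq (u x)) Ω volume
  grad_memL2 : IntegrableOn (fun x => ∑ α, ∑ i, (pder (fun y => u y α) i x) ^ 2) Ω volume
  hess_memL2 : IntegrableOn (fun x => tsq (Hess u x)) Ω volume
  zero_trace : ∀ x ∈ frontier Ω, Tendsto u (nhdsWithin x Ω) (nhds 0)

/-- The `L²(Ω)^N` norm of a vector valued map. -/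
def L2V {n N : ℕ} (Ω : Set (Euc n)) (g : Euc n → Fin N → ℝ) : ℝ :=
  Real.sqrt (∫ x in Ω, vsq (g x))

/-- The `L²(Ω)` norm of a tensor valued map. -/
def L2T {n N : ℕ} (Ω : Set (Euc n)) (G : Euc n → Fin N → Fin n → Fin n → ℝ) : ℝ :=
  Real.sqrt (∫ x in Ω, tsq (G x))

/-- The `H²(Ω)^N` norm `‖u‖_{L²} + ‖Du‖_{L²} + ‖D²u‖_{L²}`. -/
def H2norm {n N : ℕ} (Ω : Set (Euc n)) (u : Euc n → Fin N → ℝ) : ℝ :=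
  L2V Ω u + Real.sqrt (∫ x in Ω, ∑ α, ∑ i, (pder (fun y => u y α) i x) ^ 2) +
    L2T Ω (fun x => Hess u x)

end

open MeasureTheory


section
open MeasureTheory Filter Topology

lemma hasDerivAt_maxpow (k : ℕ) (x : ℝ) :
    HasDerivAt (fun t : ℝ => (max t 0) ^ (k + 2)) ((k + 2) * (max x 0) ^ (k + 1)) x := by
  rcases lt_trichotomy x 0 with h | h | h
  · have : (fun t : ℝ => (max t 0) ^ (k + 2)) =ᶠ[𝓝 x] fun _ => 0 := by
      filter_upwards [Iio_mem_nhds h] with t ht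
      simp [max_eq_right (le_of_lt (Set.mem_Iio.1 ht))]
    rw [max_eq_right h.le]
    simpa using (hasDerivAt_const x (0:ℝ)).congr_of_eventuallyEq this
  · subst h
    simp only [max_self]
    rw [hasDerivAt_iff_isLittleO]
    simp only [max_self, sub_zero, smul_eq_mul]
    have h1 : (fun t : ℝ => max t 0 ^ (k+2) - 0 ^ (k+2) - t * ((k+2) * 0 ^ (k+1)))
        = fun t : ℝ => max t 0 ^ (k+2) := by ext t; simp
    rw [h1]
    have h2 : (fun t : ℝ => max t 0 ^ (k+2)) =O[𝓝 0] fun t : ℝ => t ^ (k+2) := by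
      apply Asymptotics.IsBigO.of_bound 1
      filter_upwards with t
      rw [one_mul, norm_pow, norm_pow]
      gcongr
      rw [Real.norm_eq_abs, Real.norm_eq_abs, abs_of_nonneg (le_max_right _ _)]
      exact max_le (le_abs_self t) (abs_nonneg t)
    refine h2.trans_isLittleO ?_
    have := Asymptotics.isLittleO_pow_pow (𝕜 := ℝ) (m := 1) (n := k+2) (by omega)
    simpa using this
  · have : (fun t : ℝ => (max t 0) ^ (k + 2)) =ᶠ[𝓝 x] fun t => t ^ (k+2) := by
      filter_upwards [Ioi_mem_nhds h] with t ht
      simp [max_eq_left (le_of_lt (Set.mem_Ioi.1 ht))]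
    rw [max_eq_left h.le]
    simpa using (hasDerivAt_pow (k+2) x).congr_of_eventuallyEq this

lemma contDiff_maxsq : ContDiff ℝ 1 (fun t : ℝ => (max t 0) ^ 2) := by
  rw [contDiff_one_iff_deriv]
  refine ⟨fun x => (hasDerivAt_maxpow 0 x).differentiableAt, ?_⟩
  have : deriv (fun t : ℝ => (max t 0) ^ 2) = fun x => 2 * max x 0 := by
    ext x; simpa using (hasDerivAt_maxpow 0 x).deriv
  rw [this]; fun_prop

lemma contDiff_maxcube : ContDiff ℝ 2 (fun t : ℝ => (max t 0) ^ 3) := by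
  rw [show (2 : WithTop ℕ∞) = 1 + 1 by norm_num, contDiff_succ_iff_deriv]
  refine ⟨fun x => (hasDerivAt_maxpow 1 x).differentiableAt, by simp, ?_⟩
  have : deriv (fun t : ℝ => (max t 0) ^ 3) = fun x => 3 * max x 0 ^ 2 := by
    ext x; have := (hasDerivAt_maxpow 1 x).deriv
    norm_num at this; simpa using this
  rw [this]; exact contDiff_const.mul contDiff_maxsq

section
variable {E : Type*} [NormedAddCommGroup E] [NormedSpace ℝ E] [FiniteDimensional ℝ E]

lemma gauge_contDiffAt {Ω : Set E} (hopen : IsOpen Ω) (hconv : Convex ℝ Ω)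
    (hbdd : Bornology.IsBounded Ω) (h0 : (0:E) ∈ Ω) (ρ : E → ℝ) (hρ : ContDiff ℝ 2 ρ)
    (hΩ : Ω = {x | ρ x < 0}) (hfr : ∀ x ∈ frontier Ω, fderiv ℝ ρ x ≠ 0)
    (x : E) (hx : x ≠ 0) : ContDiffAt ℝ 2 (gauge Ω) x := by
  have hnh : Ω ∈ 𝓝 (0:E) := hopen.mem_nhds h0
  have habs : Absorbent ℝ Ω := absorbent_nhds_zero hnh
  have hvn : Bornology.IsVonNBounded ℝ Ω := NormedSpace.isVonNBounded_of_isBounded ℝ hbdd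
  have hpos : ∀ y : E, y ≠ 0 → 0 < gauge Ω y := fun y hy => (gauge_pos habs hvn).2 hy
  have hcont : Continuous (gauge Ω) := continuous_gauge hconv hnh
  have hfront : ∀ y : E, y ≠ 0 → (gauge Ω y)⁻¹ • y ∈ frontier Ω := by
    intro y hy
    rw [← gauge_eq_one_iff_mem_frontier hconv hnh, gauge_smul_of_nonneg (inv_nonneg.2 (hpos y hy).le)]
    rw [smul_eq_mul, inv_mul_cancel₀ (hpos y hy).ne']
  have hρ0 : ∀ y ∈ frontier Ω, ρ y = 0 := by
    intro y hy
    rw [hopen.frontier_eq] at hy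
    apply le_antisymm
    · have : closure Ω ⊆ {x | ρ x ≤ 0} := by
        apply closure_minimal
        · rw [hΩ]; intro z hz; exact le_of_lt (Set.mem_ofPred.1 hz)
        · exact isClosed_le hρ.continuous continuous_const
      exact this hy.1
    · by_contra h
      apply hy.2; rw [hΩ]; exact not_le.1 h
  have hdiff : Differentiable ℝ ρ := hρ.differentiable (by norm_num)
  have hpd : ∀ y ∈ frontier Ω, fderiv ℝ ρ y y ≠ 0 := by
    intro y hy hyy
    have hle : ∀ z ∈ Ω, fderiv ℝ ρ y (z - y) ≤ 0 := by
      intro z hz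
      have hline : HasDerivAt (fun t : ℝ => ρ (y + t • (z - y))) (fderiv ℝ ρ y (z - y)) 0 := by
        have h1 : HasDerivAt (fun t : ℝ => y + t • (z - y)) (z - y) 0 := by
          simpa using ((hasDerivAt_id (0:ℝ)).smul_const (z - y)).const_add y
        have h2 : HasFDerivAt ρ (fderiv ℝ ρ y) (y + (0:ℝ) • (z - y)) := by
          simpa using (hdiff y).hasFDerivAt
        exact h2.comp_hasDerivAt 0 h1
      have hmem : ∀ t : ℝ, t ∈ Set.Ioc (0:ℝ) 1 → ρ (y + t • (z - y)) < 0 := by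
        intro t ht
        have : y + t • (z - y) ∈ Ω := by
          have hyc : y ∈ closure Ω := frontier_subset_closure hy
          have := hconv.add_smul_sub_mem_interior' hyc (by rwa [hopen.interior_eq]) ht
          rwa [hopen.interior_eq] at this
        rw [hΩ] at this; exact this
      have hl := hline.tendsto_slope_zero_right
      refine le_of_tendsto hl ?_
      filter_upwards [Ioc_mem_nhdsGT (zero_lt_one' ℝ)] with t ht
      have := hmem t ht
      simp only [zero_add, zero_smul, add_zero, hρ0 y hy, sub_zero, smul_eq_mul]
      exact mul_nonpos_of_nonneg_of_nonpos (inv_nonneg.2 ht.1.le) this.le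
    apply hfr y hy
    obtain ⟨r, hr, hball⟩ := Metric.mem_nhds_iff.1 hnh
    have hz : ∀ z ∈ Metric.ball (0:E) r, fderiv ℝ ρ y z ≤ 0 := by
      intro z hz
      have := hle z (hball hz)
      rw [map_sub, hyy, sub_zero] at this; exact this
    have hall : ∀ z, fderiv ℝ ρ y z ≤ 0 := by
      intro z
      have hz1 : (0:ℝ) < r / (2 * (‖z‖ + 1)) := by positivity
      have : (r / (2 * (‖z‖ + 1))) • z ∈ Metric.ball (0:E) r := by
        rw [mem_ball_zero_iff, norm_smul, Real.norm_of_nonneg hz1.le, div_mul_eq_mul_div, div_lt_iff₀ (by positivity)]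
        nlinarith [norm_nonneg z]
      have := hz _ this
      rw [map_smul, smul_eq_mul] at this
      by_contra hc
      push Not at hc
      have := mul_pos hz1 hc
      linarith
    ext z
    have h1 := hall z
    have h2 := hall (-z)
    rw [map_neg] at h2
    simp; linarith
  set s0 := (gauge Ω x)⁻¹ with hs0
  have hs0pos : 0 < s0 := inv_pos.2 (hpos x hx)
  let f : E × ℝ → ℝ := fun p => ρ (p.2 • p.1)
  have cdf : ContDiffAt ℝ 2 f (x, s0) := by
    apply ContDiff.contDiffAt
    exact hρ.comp (contDiff_snd.smul contDiff_fst)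
  have hder : HasFDerivAt f ((fderiv ℝ ρ (s0 • x)).comp
      (s0 • ContinuousLinearMap.fst ℝ E ℝ + (ContinuousLinearMap.snd ℝ E ℝ).smulRight x)) (x, s0) := by
    have h1 : HasFDerivAt (fun p : E × ℝ => p.2 • p.1)
      (s0 • ContinuousLinearMap.fst ℝ E ℝ + (ContinuousLinearMap.snd ℝ E ℝ).smulRight x) (x, s0) :=
      (hasFDerivAt_snd (𝕜 := ℝ) (p := (x, s0))).smul (hasFDerivAt_fst (𝕜 := ℝ) (p := (x, s0)))
    exact (hdiff (s0 • x)).hasFDerivAt.comp (x, s0) h1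
  have hval : fderiv ℝ ρ (s0 • x) x ≠ 0 := by
    have := hpd _ (hfront x hx)
    rw [map_smul, smul_eq_mul] at this
    exact right_ne_zero_of_mul this
  have hinv : (fderiv ℝ f (x, s0) ∘L .inr ℝ E ℝ).IsInvertible := by
    refine ⟨ContinuousLinearEquiv.unitsEquivAut ℝ (Units.mk0 _ hval), ?_⟩
    rw [hder.fderiv]
    ext
    simp
  have hev := cdf.eventually_apply_eq_iff_implicitFunction (by norm_num) hinv
  have hC := cdf.contDiffAt_implicitFunction (by norm_num) hinv
  have hself := cdf.implicitFunction_apply_self (by norm_num) hinv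
  set ψ := cdf.implicitFunction (by norm_num) hinv
  have ht : Tendsto (fun y => (y, (gauge Ω y)⁻¹)) (𝓝 x) (𝓝 (x, s0)) := by
    apply ContinuousAt.tendsto (f := fun y => (y, (gauge Ω y)⁻¹))
    exact continuousAt_id.prodMk (hcont.continuousAt.inv₀ (hpos x hx).ne')
  have hev2 := ht.eventually hev
  have heq : gauge Ω =ᶠ[𝓝 x] fun y => (ψ y)⁻¹ := by
    filter_upwards [hev2, isOpen_ne.mem_nhds hx] with y hy hy0
    have : f (y, (gauge Ω y)⁻¹) = f (x, s0) := by
      simp only [f]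
      rw [hρ0 _ (hfront y hy0), hρ0 _ (hfront x hx)]
    have := hy.1 this
    rw [this, inv_inv]
  refine ContDiffAt.congr_of_eventuallyEq ?_ heq
  apply hC.inv
  simp only at hself
  rw [hself]; exact hs0pos.ne'

lemma exists_G0 {Ω : Set E} (hopen : IsOpen Ω) (hconv : Convex ℝ Ω)
    (hbdd : Bornology.IsBounded Ω) (h0 : (0:E) ∈ Ω) (ρ : E → ℝ) (hρ : ContDiff ℝ 2 ρ)
    (hΩ : Ω = {x | ρ x < 0}) (hfr : ∀ x ∈ frontier Ω, fderiv ℝ ρ x ≠ 0) :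
    ∃ G : E → ℝ, ContDiff ℝ 2 G ∧ ConvexOn ℝ Set.univ G ∧ Ω = {x | G x < 1} ∧ G 0 = 0 := by
  have hnh : Ω ∈ 𝓝 (0:E) := hopen.mem_nhds h0
  have habs : Absorbent ℝ Ω := absorbent_nhds_zero hnh
  have hcont : Continuous (gauge Ω) := continuous_gauge hconv hnh
  refine ⟨fun x => 8 * (max (gauge Ω x - 1/2) 0) ^ 3, ?_, ?_, ?_, ?_⟩
  · rw [contDiff_iff_contDiffAt]
    intro x
    by_cases hx : x = 0
    · have : (fun x => 8 * (max (gauge Ω x - 1/2) 0) ^ 3) =ᶠ[𝓝 x] fun _ => 0 := by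
        have : ∀ᶠ y in 𝓝 x, gauge Ω y < 1/2 := by
          apply (hcont.tendsto x).eventually_lt_const
          rw [hx, gauge_zero]; norm_num
        filter_upwards [this] with y hy
        rw [max_eq_right (by linarith)]; norm_num
      exact contDiffAt_const.congr_of_eventuallyEq this
    · have h1 := gauge_contDiffAt hopen hconv hbdd h0 ρ hρ hΩ hfr x hx
      apply contDiffAt_const.mul
      exact (contDiff_maxcube.contDiffAt).comp x (h1.sub contDiffAt_const)
  · have hg : ConvexOn ℝ Set.univ (gauge Ω) := by
      refine ⟨convex_univ, fun x _ y _ a b ha hb _ => ?_⟩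
      calc gauge Ω (a • x + b • y) ≤ gauge Ω (a • x) + gauge Ω (b • y) := gauge_add_le hconv habs _ _
        _ = _ := by rw [gauge_smul_of_nonneg ha, gauge_smul_of_nonneg hb]
    have h1 : ConvexOn ℝ Set.univ (fun x => max (gauge Ω x - 1/2) 0) :=
      (hg.sub (concaveOn_const _ convex_univ)).sup (convexOn_const 0 convex_univ)
    have h2 := h1.pow (fun x _ => le_max_right _ _) 3
    exact h2.smul (c := 8) (by norm_num)
  · ext x
    have h1 : x ∈ Ω ↔ gauge Ω x < 1 := by
      have := setOfPred_gauge_lt_one_eq_self_of_isOpen hconv h0 hopen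
      exact (Set.ext_iff.1 this x).symm
    rw [h1]
    simp only [Set.mem_ofPred_eq]
    constructor
    · intro h
      have h3 : max (gauge Ω x - 1/2) 0 < 1/2 := max_lt (by linarith) (by norm_num)
      have h4 := pow_lt_pow_left₀ h3 (le_max_right _ _) (n := 3) (by norm_num)
      norm_num at h4 ⊢; linarith
    · intro h
      by_contra hc
      push Not at hc
      have h3 : 1/2 ≤ max (gauge Ω x - 1/2) 0 := le_trans (by linarith) (le_max_left _ _)
      have h4 := pow_le_pow_left₀ (by norm_num) h3 3
      norm_num at h4 h; linarith
  · simp only [gauge_zero]; rw [max_eq_right (by norm_num)]; norm_num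

lemma exists_G {Ω : Set E} (hopen : IsOpen Ω) (hconv : Convex ℝ Ω)
    (hbdd : Bornology.IsBounded Ω) (hne : Ω.Nonempty) (ρ : E → ℝ) (hρ : ContDiff ℝ 2 ρ)
    (hΩ : Ω = {x | ρ x < 0}) (hfr : ∀ x ∈ frontier Ω, fderiv ℝ ρ x ≠ 0) :
    ∃ (G : E → ℝ) (x0 : E), ContDiff ℝ 2 G ∧ ConvexOn ℝ Set.univ G ∧ Ω = {x | G x < 1} ∧ G x0 = 0 := by
  obtain ⟨x0, hx0⟩ := hne
  let e : E ≃ₜ E := Homeomorph.addRight x0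
  let Ω' : Set E := (fun x => x + x0) ⁻¹' Ω
  obtain ⟨G, hG1, hG2, hG3, hG4⟩ := exists_G0 (Ω := Ω')
    (hopen.preimage (by fun_prop)) (hconv.translate_preimage_left x0)
    (by
      have : Ω' = (fun x => x + (-x0)) '' Ω := by
        ext y; simp [Ω']
      rw [this]
      exact ((isometry_add_right (-x0)).lipschitz).isBounded_image hbdd)
    (by simpa [Ω'] using hx0) (fun x => ρ (x + x0)) (hρ.comp (by fun_prop))
    (by simp only [Ω', hΩ]; rfl)
    (by
      intro x hx
      rw [fderiv_comp_add_right]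
      apply hfr
      have : frontier Ω' = e ⁻¹' frontier Ω := (e.preimage_frontier Ω).symm
      rw [this] at hx
      exact hx)
  refine ⟨fun x => G (x - x0), x0, hG1.comp (by fun_prop), ?_, ?_, by simpa using hG4⟩
  · have := hG2.translate_left (-x0)
    simpa [Function.comp_def, sub_eq_add_neg] using this
  · ext x
    have := Set.ext_iff.1 hG3 (x - x0)
    simpa [Ω'] using this
end
end


section
open MeasureTheory Filter Topology

noncomputable def dd {E : Type*} [NormedAddCommGroup E] [NormedSpace ℝ E] (f : E → ℝ) (x p q : E) : ℝ :=
  fderiv ℝ (fderiv ℝ f) x p q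

section
variable {E : Type*} [NormedAddCommGroup E] [NormedSpace ℝ E]

lemma fderiv_cd1 {Ω : Set E} (hΩ : IsOpen Ω) {f : E → ℝ} (hf : ContDiffOn ℝ 2 f Ω) :
    ContDiffOn ℝ 1 (fderiv ℝ f) Ω := hf.fderiv_of_isOpen hΩ (by norm_num)

lemma fderiv_cd1' {Ω : Set E} (hΩ : IsOpen Ω) {f : E → ℝ} (hf : ContDiffOn ℝ 2 f Ω) (q : E) :
    ContDiffOn ℝ 1 (fun y => fderiv ℝ f y q) Ω :=
  (fderiv_cd1 hΩ hf).clm_apply contDiffOn_const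

lemma cd1_diffAt {Ω : Set E} (hΩ : IsOpen Ω) {f : E → ℝ} (hf : ContDiffOn ℝ 1 f Ω) {x : E}
    (hx : x ∈ Ω) : DifferentiableAt ℝ f x :=
  (hf.differentiableOn (by norm_num)).differentiableAt (hΩ.mem_nhds hx)

lemma dd_eq {Ω : Set E} (hΩ : IsOpen Ω) {f : E → ℝ} (hf : ContDiffOn ℝ 2 f Ω) {x : E}
    (hx : x ∈ Ω) (p q : E) : fderiv ℝ (fun y => fderiv ℝ f y q) x p = dd f x p q := by
  have h : DifferentiableAt ℝ (fderiv ℝ f) x :=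
    ((fderiv_cd1 hΩ hf).differentiableOn (by norm_num)).differentiableAt (hΩ.mem_nhds hx)
  rw [fderiv_clm_apply h (differentiableAt_const _)]
  simp [dd]

lemma dd_symm {Ω : Set E} (hΩ : IsOpen Ω) {f : E → ℝ} (hf : ContDiffOn ℝ 2 f Ω) {x : E}
    (hx : x ∈ Ω) (p q : E) : dd f x p q = dd f x q p := by
  have h := (hf.contDiffAt (hΩ.mem_nhds hx)).isSymmSndFDerivAt (by simp)
  exact h p q

lemma dd_cont {Ω : Set E} (hΩ : IsOpen Ω) {f : E → ℝ} (hf : ContDiffOn ℝ 2 f Ω) (p q : E) :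
    ContinuousOn (fun x => dd f x p q) Ω := by
  have h := (fderiv_cd1 hΩ hf).continuousOn_fderiv_of_isOpen hΩ (by norm_num)
  exact (h.clm_apply continuousOn_const).clm_apply continuousOn_const

lemma ext_cd {Ω K : Set E} (hΩ : IsOpen Ω) (hK : IsCompact K) (hKΩ : K ⊆ Ω) {f : E → ℝ} {k : ℕ∞}
    (hf : ContDiffOn ℝ k f Ω) (h0 : ∀ x, x ∉ K → f x = 0) : ContDiff ℝ k f := by
  rw [contDiff_iff_contDiffAt]
  intro x
  by_cases hx : x ∈ Ω
  · exact hf.contDiffAt (hΩ.mem_nhds hx)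
  · have : f =ᶠ[𝓝 x] fun _ => 0 := by
      filter_upwards [hK.isClosed.isOpen_compl.mem_nhds (fun h => hx (hKΩ h))] with y hy
      exact h0 y hy
    exact contDiffAt_const.congr_of_eventuallyEq this

lemma ext_cont {Ω K : Set E} (hΩ : IsOpen Ω) (hK : IsCompact K) (hKΩ : K ⊆ Ω) {f : E → ℝ}
    (hf : ContinuousOn f Ω) (h0 : ∀ x, x ∉ K → f x = 0) : Continuous f := by
  have := ext_cd (k := 0) hΩ hK hKΩ ((contDiffOn_zero (𝕜 := ℝ)).2 hf) h0
  exact this.continuous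

lemma fderiv_zero_off {K : Set E} (hK : IsCompact K) {f : E → ℝ}
    (h0 : ∀ x, x ∉ K → f x = 0) (x : E) (hx : x ∉ K) : fderiv ℝ f x = 0 := by
  have : f =ᶠ[𝓝 x] fun _ => 0 := by
    filter_upwards [hK.isClosed.isOpen_compl.mem_nhds hx] with y hy
    exact h0 y hy
  rw [this.fderiv_eq]; simp

lemma dd_zero_off {K : Set E} (hK : IsCompact K) {f : E → ℝ}
    (h0 : ∀ x, x ∉ K → f x = 0) (x : E) (hx : x ∉ K) (p q : E) : dd f x p q = 0 := by
  have : fderiv ℝ f =ᶠ[𝓝 x] fun _ => 0 := by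
    filter_upwards [hK.isClosed.isOpen_compl.mem_nhds hx] with y hy
    exact fderiv_zero_off hK h0 y hy
  unfold dd
  rw [this.fderiv_eq]; simp

variable [FiniteDimensional ℝ E] [MeasurableSpace E] [BorelSpace E] (μ : Measure E) [μ.IsAddHaarMeasure]

lemma ibp0 {f : E → ℝ} (hf : ContDiff ℝ 1 f) (hs : HasCompactSupport f) (p : E) :
    ∫ x, fderiv ℝ f x p ∂μ = 0 := by
  have hfi : Integrable (fun x => fderiv ℝ f x p) μ := by
    apply Continuous.integrable_of_hasCompactSupport
    · exact (hf.continuous_fderiv (by norm_num)).clm_apply continuous_const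
    · exact hs.fderiv_apply ℝ p
  have := integral_mul_fderiv_eq_neg_fderiv_mul_of_integrable (μ := μ) (f := fun _ : E => (1:ℝ)) (g := f) (v := p)
    (by simp) (by simpa using hfi)
    (by simpa using hf.continuous.integrable_of_hasCompactSupport hs)
    (by simp) (fun x _ => (hf.differentiable (by norm_num)) x)
  simpa using this

lemma int_of_cont {Ω K : Set E} (hΩ : IsOpen Ω) (hK : IsCompact K) (hKΩ : K ⊆ Ω) {f : E → ℝ}
    (hf : ContinuousOn f Ω) (h0 : ∀ x, x ∉ K → f x = 0) : Integrable f (μ.restrict Ω) := by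
  apply Integrable.restrict
  exact (ext_cont hΩ hK hKΩ hf h0).integrable_of_hasCompactSupport (HasCompactSupport.intro hK h0)

lemma ibpΩ {Ω K : Set E} (hΩ : IsOpen Ω) (hK : IsCompact K) (hKΩ : K ⊆ Ω) {f : E → ℝ}
    (hf : ContDiffOn ℝ 1 f Ω) (h0 : ∀ x, x ∉ K → f x = 0) (p : E) :
    IntegrableOn (fun x => fderiv ℝ f x p) Ω μ ∧ ∫ x in Ω, fderiv ℝ f x p ∂μ = 0 := by
  have hs : HasCompactSupport f := HasCompactSupport.intro hK h0
  have hc : ContDiff ℝ 1 f := ext_cd hΩ hK hKΩ hf h0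
  constructor
  · apply int_of_cont μ hΩ hK hKΩ
    · exact ((hc.continuous_fderiv (by norm_num)).clm_apply continuous_const).continuousOn
    · intro x hx; rw [fderiv_zero_off hK h0 x hx]; simp
  · rw [setIntegral_eq_integral_of_forall_compl_eq_zero]
    · exact ibp0 μ hc hs p
    · intro x hx; rw [fderiv_zero_off hK h0 x (fun h => hx (hKΩ h))]; simp

lemma J0 {a b : E → ℝ} (ha : ContDiff ℝ 1 a) (hb : ContDiff ℝ 1 b) (hsa : HasCompactSupport a)
    (hsb : HasCompactSupport b) (p q : E) :
    ∫ x, fderiv ℝ b x q * fderiv ℝ a x p ∂μ = ∫ x, fderiv ℝ a x q * fderiv ℝ b x p ∂μ := by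
  obtain ⟨Ca, hCa⟩ := ha.lipschitzWith_of_hasCompactSupport hsa (by norm_num)
  obtain ⟨Cb, hCb⟩ := hb.lipschitzWith_of_hasCompactSupport hsb (by norm_num)
  have hda : Differentiable ℝ a := ha.differentiable (by norm_num)
  have hdb : Differentiable ℝ b := hb.differentiable (by norm_num)
  have cap : Continuous (fun x => fderiv ℝ a x p) :=
    (ha.continuous_fderiv (by norm_num)).clm_apply continuous_const
  have cbp : Continuous (fun x => fderiv ℝ b x p) :=
    (hb.continuous_fderiv (by norm_num)).clm_apply continuous_const
  have iap : Integrable (fun x => fderiv ℝ a x p) μ :=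
    cap.integrable_of_hasCompactSupport (hsa.fderiv_apply ℝ p)
  have ibp : Integrable (fun x => fderiv ℝ b x p) μ :=
    cbp.integrable_of_hasCompactSupport (hsb.fderiv_apply ℝ p)
  have A := hCb.integral_inv_smul_sub_mul_tendsto_integral_lineDeriv_mul iap q
  have B := hCa.integral_inv_smul_sub_mul_tendsto_integral_lineDeriv_mul ibp (-q)
  simp only [fun x => (hdb x).lineDeriv_eq_fderiv (v := q)] at A
  simp only [fun x => (hda x).lineDeriv_eq_fderiv (v := -q)] at B
  have key : ∀ t : ℝ, ∫ x, (t⁻¹ • (b (x + t • q) - b x)) * fderiv ℝ a x p ∂μ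
      = - ∫ x, (t⁻¹ • (a (x + t • (-q)) - a x)) * fderiv ℝ b x p ∂μ := by
    intro t
    have hshift : ∀ x, HasFDerivAt (fun x => b (x + t • q)) (fderiv ℝ b (x + t • q)) x := by
      intro x
      exact (hasFDerivAt_comp_add_right (t • q)).2 (hdb (x + t • q)).hasFDerivAt
    have hscomp : HasCompactSupport (fun x => b (x + t • q)) :=
      hsb.comp_homeomorph (Homeomorph.addRight (t • q))
    have hscomp' : HasCompactSupport (fun x => a (x + t • (-q))) :=
      hsa.comp_homeomorph (Homeomorph.addRight (t • (-q)))
    have csh : Continuous (fun x => fderiv ℝ b (x + t • q) p) := cbp.comp (by fun_prop)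
    have i1 : Integrable (fun x => b (x + t • q) * fderiv ℝ a x p) μ :=
      ((hb.continuous.comp (by fun_prop)).mul cap).integrable_of_hasCompactSupport hscomp.mul_right
    have i2 : Integrable (fun x => b x * fderiv ℝ a x p) μ :=
      (hb.continuous.mul cap).integrable_of_hasCompactSupport hsb.mul_right
    have i3 : Integrable (fun x => a (x + t • (-q)) * fderiv ℝ b x p) μ :=
      ((ha.continuous.comp (by fun_prop)).mul cbp).integrable_of_hasCompactSupport hscomp'.mul_right
    have i4 : Integrable (fun x => a x * fderiv ℝ b x p) μ :=
      (ha.continuous.mul cbp).integrable_of_hasCompactSupport hsa.mul_right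
    have i5 : Integrable (fun x => fderiv ℝ b (x + t • q) p * a x) μ :=
      (csh.mul ha.continuous).integrable_of_hasCompactSupport hsa.mul_left
    have e1 : ∫ x, b (x + t • q) * fderiv ℝ a x p ∂μ = - ∫ x, fderiv ℝ b (x + t • q) p * a x ∂μ := by
      have hfe : ∀ x, fderiv ℝ (fun x => b (x + t • q)) x = fderiv ℝ b (x + t • q) :=
        fun x => (hshift x).fderiv
      have := integral_mul_fderiv_eq_neg_fderiv_mul_of_integrable (μ := μ)
        (f := fun x => b (x + t • q)) (g := a) (v := p)
        (by simpa only [hfe] using i5) i1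
        (((hb.continuous.comp (by fun_prop)).mul ha.continuous).integrable_of_hasCompactSupport hsa.mul_left)
        (fun x _ => (hshift x).differentiableAt) (fun x _ => hda x)
      simpa only [hfe] using this
    have e2 : ∫ x, b x * fderiv ℝ a x p ∂μ = - ∫ x, fderiv ℝ b x p * a x ∂μ := by
      exact integral_mul_fderiv_eq_neg_fderiv_mul_of_integrable (μ := μ)
        (f := b) (g := a) (v := p) (by simpa only [mul_comm] using i4) i2
        ((hb.continuous.mul ha.continuous).integrable_of_hasCompactSupport hsa.mul_left)
        (fun x _ => hdb x) (fun x _ => hda x)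
    have e3 : ∫ x, fderiv ℝ b (x + t • q) p * a x ∂μ = ∫ x, a (x + t • (-q)) * fderiv ℝ b x p ∂μ := by
      rw [← integral_add_right_eq_self _ (t • (-q))]
      simp [mul_comm]
    simp only [smul_eq_mul, mul_assoc, integral_const_mul]
    rw [← mul_neg]
    congr 1
    simp only [sub_mul]
    rw [integral_sub i1 i2, integral_sub i3 i4, e1, e2, e3]
    simp only [mul_comm (fderiv ℝ b _ p)]
    ring
  simp only [key] at A
  have C := tendsto_nhds_unique A B.neg
  rw [C, ← integral_neg]
  simp

end
end


section
open MeasureTheory Filter Topology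
open scoped Manifold ContDiff
section
variable {E : Type*} [NormedAddCommGroup E] [NormedSpace ℝ E]

lemma fderiv_mul_apply {a b : E → ℝ} {x : E} (ha : DifferentiableAt ℝ a x)
    (hb : DifferentiableAt ℝ b x) (p : E) :
    fderiv ℝ (fun y => a y * b y) x p = a x * fderiv ℝ b x p + fderiv ℝ a x p * b x := by
  rw [fderiv_fun_mul ha hb]; simp [mul_comm]

variable [FiniteDimensional ℝ E] [MeasurableSpace E] [BorelSpace E] (μ : Measure E) [μ.IsAddHaarMeasure]

lemma nullLag1 {Ω K : Set E} (hΩ : IsOpen Ω) (hK : IsCompact K) (hKΩ : K ⊆ Ω) {w φ : E → ℝ}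
    (hw : ContDiffOn ℝ 2 w Ω) (hφ : ContDiff ℝ 2 φ) (h0 : ∀ x, x ∉ K → φ x = 0) (p q : E) :
    ∫ x in Ω, (φ x * (dd w x p p * dd w x q q - dd w x p q ^ 2)
      + fderiv ℝ w x p * (fderiv ℝ φ x p * dd w x q q - fderiv ℝ φ x q * dd w x p q)) ∂μ = 0 := by
  obtain ⟨K', hK', hKK', hK'Ω⟩ := exists_compact_between hK hΩ hKΩ
  obtain ⟨η, hη1, hη0, -⟩ := exists_contMDiffMap_one_nhds_of_subset_interior (n := ⊤) 𝓘(ℝ, E)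
    hK.isClosed hKK'
  have hηc : ContDiff ℝ 1 η := by
    have := η.contMDiff.contDiff
    exact this.of_le (by norm_cast)
  have hwp := fderiv_cd1' hΩ hw p
  have hwq := fderiv_cd1' hΩ hw q
  have hφ1 : ContDiff ℝ 1 φ := hφ.of_le (by norm_num)
  let a : E → ℝ := fun x => φ x * fderiv ℝ w x p
  let b : E → ℝ := fun x => η x * fderiv ℝ w x q
  have ha0 : ∀ x, x ∉ K → a x = 0 := fun x hx => by simp [a, h0 x hx]
  have hb0 : ∀ x, x ∉ K' → b x = 0 := fun x hx => by simp [b, hη0 x hx]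
  have ha : ContDiff ℝ 1 a := ext_cd hΩ hK hKΩ (hφ1.contDiffOn.mul hwp) ha0
  have hb : ContDiff ℝ 1 b := ext_cd hΩ hK' hK'Ω (hηc.contDiffOn.mul hwq) hb0
  have hsa : HasCompactSupport a := HasCompactSupport.intro hK ha0
  have hsb : HasCompactSupport b := HasCompactSupport.intro hK' hb0
  have hJ := J0 μ ha hb hsa hsb p q
  have ca : ∀ r, Continuous (fun x => fderiv ℝ a x r) := fun r =>
    (ha.continuous_fderiv (by norm_num)).clm_apply continuous_const
  have cb : ∀ r, Continuous (fun x => fderiv ℝ b x r) := fun r =>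
    (hb.continuous_fderiv (by norm_num)).clm_apply continuous_const
  have i1 : Integrable (fun x => fderiv ℝ b x q * fderiv ℝ a x p) μ :=
    ((cb q).mul (ca p)).integrable_of_hasCompactSupport (hsb.fderiv_apply ℝ q).mul_right
  have i2 : Integrable (fun x => fderiv ℝ a x q * fderiv ℝ b x p) μ :=
    ((ca q).mul (cb p)).integrable_of_hasCompactSupport (hsa.fderiv_apply ℝ q).mul_right
  have hJ2 : ∫ x, (fderiv ℝ b x q * fderiv ℝ a x p - fderiv ℝ a x q * fderiv ℝ b x p) ∂μ = 0 := by
    rw [integral_sub i1 i2, hJ, sub_self]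
  have e := setIntegral_eq_integral_of_forall_compl_eq_zero (μ := μ) (s := Ω)
    (f := fun x => fderiv ℝ b x q * fderiv ℝ a x p - fderiv ℝ a x q * fderiv ℝ b x p)
    (by
      intro x hx
      simp [fderiv_zero_off hK ha0 x (fun h => hx (hKΩ h))])
  refine Eq.trans ?_ (e.trans hJ2)
  · apply setIntegral_congr_fun hΩ.measurableSet
    intro x hx
    by_cases hxK : x ∈ K
    · have hbe : b =ᶠ[𝓝 x] fun y => fderiv ℝ w y q := by
        have : ∀ᶠ y in 𝓝 x, η y = 1 := hη1.filter_mono (nhds_le_nhdsSet hxK)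
        filter_upwards [this] with y hy
        simp [b, hy]
      have hb' : ∀ r, fderiv ℝ b x r = dd w x r q := by
        intro r; rw [hbe.fderiv_eq, dd_eq hΩ hw hx]
      have ha' : ∀ r, fderiv ℝ a x r = φ x * dd w x r p + fderiv ℝ φ x r * fderiv ℝ w x p := by
        intro r
        simp only [a]
        rw [fderiv_mul_apply (hφ1.differentiable (by norm_num) x) (cd1_diffAt hΩ hwp hx), dd_eq hΩ hw hx]
      simp only [ha', hb']
      rw [dd_symm hΩ hw hx q p]
      ring
    · simp only [fderiv_zero_off hK ha0 x hxK, fderiv_zero_off hK h0 x hxK, h0 x hxK]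
      simp

lemma nullLag {Ω K : Set E} (hΩ : IsOpen Ω) (hK : IsCompact K) (hKΩ : K ⊆ Ω) {w φ : E → ℝ}
    (hw : ContDiffOn ℝ 2 w Ω) (hφ : ContDiff ℝ 2 φ) (h0 : ∀ x, x ∉ K → φ x = 0) (p q : E) :
    ∫ x in Ω, (φ x * (dd w x p p * dd w x q q - dd w x p q ^ 2)
      + 1/2 * (dd φ x p p * fderiv ℝ w x q ^ 2 - 2 * dd φ x p q * fderiv ℝ w x p * fderiv ℝ w x q
        + dd φ x q q * fderiv ℝ w x p ^ 2)) ∂μ = 0 := by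
  have hwp := fderiv_cd1' hΩ hw p
  have hwq := fderiv_cd1' hΩ hw q
  have hφΩ : ContDiffOn ℝ 2 φ Ω := hφ.contDiffOn
  have hφp := fderiv_cd1' hΩ hφΩ p
  have hφq := fderiv_cd1' hΩ hφΩ q
  have T := nullLag1 μ hΩ hK hKΩ hw hφ h0 p q
  have z : ∀ r x, x ∉ K → fderiv ℝ φ x r = 0 := fun r x hx => by
    rw [fderiv_zero_off hK h0 x hx]; simp
  obtain ⟨i1, e1⟩ := ibpΩ μ hΩ hK hKΩ (f := fun y => fderiv ℝ φ y q * (fderiv ℝ w y p * fderiv ℝ w y p))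
    (hφq.mul (hwp.mul hwp)) (fun x hx => by simp [z q x hx]) q
  obtain ⟨i2, e2⟩ := ibpΩ μ hΩ hK hKΩ (f := fun y => fderiv ℝ φ y p * (fderiv ℝ w y p * fderiv ℝ w y q))
    (hφp.mul (hwp.mul hwq)) (fun x hx => by simp [z p x hx]) q
  obtain ⟨i3, e3⟩ := ibpΩ μ hΩ hK hKΩ (f := fun y => fderiv ℝ φ y p * (fderiv ℝ w y q * fderiv ℝ w y q))
    (hφp.mul (hwq.mul hwq)) (fun x hx => by simp [z p x hx]) p
  have iT : Integrable (fun x => (φ x * (dd w x p p * dd w x q q - dd w x p q ^ 2)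
      + fderiv ℝ w x p * (fderiv ℝ φ x p * dd w x q q - fderiv ℝ φ x q * dd w x p q))) (μ.restrict Ω) := by
    apply int_of_cont μ hΩ hK hKΩ
    · have c1 := dd_cont hΩ hw p p
      have c2 := dd_cont hΩ hw p q
      have c3 := dd_cont hΩ hw q q
      have c4 := hwp.continuousOn
      have c5 := hφp.continuousOn
      have c6 := hφq.continuousOn
      have c7 := hφΩ.continuousOn
      fun_prop
    · intro x hx
      simp [h0 x hx, z p x hx, z q x hx]
  have expand : ∀ x ∈ Ω, φ x * (dd w x p p * dd w x q q - dd w x p q ^ 2)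
      + 1/2 * (dd φ x p p * fderiv ℝ w x q ^ 2 - 2 * dd φ x p q * fderiv ℝ w x p * fderiv ℝ w x q
        + dd φ x q q * fderiv ℝ w x p ^ 2) =
      (φ x * (dd w x p p * dd w x q q - dd w x p q ^ 2)
      + fderiv ℝ w x p * (fderiv ℝ φ x p * dd w x q q - fderiv ℝ φ x q * dd w x p q))
      + (1/2 * fderiv ℝ (fun y => fderiv ℝ φ y q * (fderiv ℝ w y p * fderiv ℝ w y p)) x q
        + (1/2 * fderiv ℝ (fun y => fderiv ℝ φ y p * (fderiv ℝ w y q * fderiv ℝ w y q)) x p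
        - fderiv ℝ (fun y => fderiv ℝ φ y p * (fderiv ℝ w y p * fderiv ℝ w y q)) x q)) := by
    intro x hx
    have dp := cd1_diffAt hΩ hwp hx
    have dq := cd1_diffAt hΩ hwq hx
    have fp := cd1_diffAt hΩ hφp hx
    have fq := cd1_diffAt hΩ hφq hx
    rw [fderiv_mul_apply fq (dp.fun_mul dp), fderiv_mul_apply dp dp,
      fderiv_mul_apply fp (dq.fun_mul dq), fderiv_mul_apply dq dq,
      fderiv_mul_apply fp (dp.fun_mul dq), fderiv_mul_apply dp dq]
    simp only [dd_eq hΩ hw hx, dd_eq hΩ hφΩ hx]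
    rw [dd_symm hΩ hw hx q p, dd_symm hΩ hφΩ hx q p]
    ring
  rw [setIntegral_congr_fun hΩ.measurableSet expand]
  have i23 := (i3.const_mul (1/2)).sub i2
  have i123 := (i1.const_mul (1/2)).add i23
  simp only [Pi.add_def, Pi.sub_def] at i23 i123
  rw [integral_add iT i123, integral_add (i1.const_mul (1/2)) i23, integral_sub (i3.const_mul (1/2)) i2,
    integral_const_mul, integral_const_mul, T, e1, e2, e3]
  ring

lemma tang {Ω K : Set E} (hΩ : IsOpen Ω) (hK : IsCompact K) (hKΩ : K ⊆ Ω) {w G : E → ℝ} {W : ℝ → ℝ}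
    (hw : ContDiffOn ℝ 2 w Ω) (hG : ContDiff ℝ 2 G) (hW : ContDiff ℝ 1 W)
    (h0 : ∀ x, x ∉ K → W (G x) = 0) (p q : E) :
    IntegrableOn (fun x => W (G x) * (fderiv ℝ G x p * fderiv ℝ w x q - fderiv ℝ G x q * fderiv ℝ w x p) ^ 2) Ω μ ∧
    ∃ R : E → ℝ, (∀ x ∈ Ω, R x = 
      fderiv ℝ G x p * (dd G x q p * fderiv ℝ w x q + fderiv ℝ G x p * dd w x q q
          - dd G x q q * fderiv ℝ w x p - fderiv ℝ G x q * dd w x q p)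
      - fderiv ℝ G x q * (dd G x p p * fderiv ℝ w x q + fderiv ℝ G x p * dd w x p q
          - dd G x p q * fderiv ℝ w x p - fderiv ℝ G x q * dd w x p p)) ∧
    IntegrableOn (fun x => W (G x) * w x * R x) Ω μ ∧
    ∫ x in Ω, W (G x) * (fderiv ℝ G x p * fderiv ℝ w x q - fderiv ℝ G x q * fderiv ℝ w x p) ^ 2 ∂μ
      = - ∫ x in Ω, W (G x) * w x * R x ∂μ := by
  have hwp := fderiv_cd1' hΩ hw p
  have hwq := fderiv_cd1' hΩ hw q
  have hGΩ : ContDiffOn ℝ 2 G Ω := hG.contDiffOn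
  have hGp := fderiv_cd1' hΩ hGΩ p
  have hGq := fderiv_cd1' hΩ hGΩ q
  have hw1 : ContDiffOn ℝ 1 w Ω := hw.of_le (by norm_num)
  have hG1 : ContDiffOn ℝ 1 G Ω := hGΩ.of_le (by norm_num)
  have hWG : ContDiffOn ℝ 1 (fun x => W (G x)) Ω := hW.comp_contDiffOn hG1
  let f : E → ℝ := fun x => fderiv ℝ G x p * fderiv ℝ w x q - fderiv ℝ G x q * fderiv ℝ w x p
  have hf : ContDiffOn ℝ 1 f Ω := (hGp.mul hwq).sub (hGq.mul hwp)
  have cf : ContinuousOn (fun x => fderiv ℝ f x) Ω := hf.continuousOn_fderiv_of_isOpen hΩ (by norm_num)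
  have i1 : IntegrableOn (fun x => W (G x) * (f x) ^ 2) Ω μ := by
    apply int_of_cont μ hΩ hK hKΩ
    · exact hWG.continuousOn.mul (hf.continuousOn.pow 2)
    · intro x hx; simp [h0 x hx]
  refine ⟨i1, fun x => fderiv ℝ G x p * fderiv ℝ f x q - fderiv ℝ G x q * fderiv ℝ f x p, ?_, ?_, ?_⟩
  · intro x hx
    have dp := cd1_diffAt hΩ hwp hx
    have dq := cd1_diffAt hΩ hwq hx
    have fp := cd1_diffAt hΩ hGp hx
    have fq := cd1_diffAt hΩ hGq hx
    have : ∀ r, fderiv ℝ f x r = dd G x r p * fderiv ℝ w x q + fderiv ℝ G x p * dd w x r q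
          - dd G x r q * fderiv ℝ w x p - fderiv ℝ G x q * dd w x r p := by
      intro r
      simp only [f]
      rw [fderiv_fun_sub (fp.fun_mul dq) (fq.fun_mul dp)]
      rw [sub_apply, fderiv_mul_apply fp dq, fderiv_mul_apply fq dp]
      simp only [dd_eq hΩ hw hx, dd_eq hΩ hGΩ hx]
      ring
    simp only [this]
  · apply int_of_cont μ hΩ hK hKΩ
    · have c1 := hWG.continuousOn
      have c2 := hw1.continuousOn
      have c3 := hGp.continuousOn
      have c4 := hGq.continuousOn
      have c5 : ContinuousOn (fun x => fderiv ℝ f x p) Ω := cf.clm_apply continuousOn_const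
      have c6 : ContinuousOn (fun x => fderiv ℝ f x q) Ω := cf.clm_apply continuousOn_const
      exact (c1.mul c2).mul ((c3.mul c6).sub (c4.mul c5))
    · intro x hx; simp [h0 x hx]
  · obtain ⟨j1, e1⟩ := ibpΩ μ hΩ hK hKΩ (f := fun y => W (G y) * (w y * (f y * fderiv ℝ G y p)))
      (hWG.mul (hw1.mul (hf.mul hGp))) (fun x hx => by simp [h0 x hx]) q
    obtain ⟨j2, e2⟩ := ibpΩ μ hΩ hK hKΩ (f := fun y => W (G y) * (w y * (f y * fderiv ℝ G y q)))
      (hWG.mul (hw1.mul (hf.mul hGq))) (fun x hx => by simp [h0 x hx]) p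
    have expand : ∀ x ∈ Ω, W (G x) * (f x) ^ 2 = 
        (fderiv ℝ (fun y => W (G y) * (w y * (f y * fderiv ℝ G y p))) x q
        - fderiv ℝ (fun y => W (G y) * (w y * (f y * fderiv ℝ G y q))) x p)
        + -(W (G x) * w x * (fderiv ℝ G x p * fderiv ℝ f x q - fderiv ℝ G x q * fderiv ℝ f x p)) := by
      intro x hx
      have fp := cd1_diffAt hΩ hGp hx
      have fq := cd1_diffAt hΩ hGq hx
      have ff := cd1_diffAt hΩ hf hx
      have fw := cd1_diffAt hΩ hw1 hx
      have fW := cd1_diffAt hΩ hWG hx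
      have fG := cd1_diffAt hΩ hG1 hx
      have eW : ∀ r, fderiv ℝ (fun y => W (G y)) x r = deriv W (G x) * fderiv ℝ G x r := by
        intro r
        have hWd : HasDerivAt W (deriv W (G x)) (G x) :=
          ((hW.differentiable (by norm_num)) (G x)).hasDerivAt
        have := hWd.comp_hasFDerivAt x fG.hasFDerivAt
        have e := this.fderiv
        simp only [Function.comp_def] at e
        rw [e]; simp
      rw [fderiv_mul_apply fW (fw.fun_mul (ff.fun_mul fp)), fderiv_mul_apply fw (ff.fun_mul fp),
        fderiv_mul_apply ff fp,
        fderiv_mul_apply fW (fw.fun_mul (ff.fun_mul fq)), fderiv_mul_apply fw (ff.fun_mul fq),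
        fderiv_mul_apply ff fq, eW, eW]
      simp only [dd_eq hΩ hGΩ hx]
      rw [dd_symm hΩ hGΩ hx q p]
      simp only [f]
      ring
    have i2 : IntegrableOn (fun x => W (G x) * w x * (fderiv ℝ G x p * fderiv ℝ f x q - fderiv ℝ G x q * fderiv ℝ f x p)) Ω μ := by
      apply int_of_cont μ hΩ hK hKΩ
      · have c1 := hWG.continuousOn
        have c2 := hw1.continuousOn
        have c3 := hGp.continuousOn
        have c4 := hGq.continuousOn
        have c5 : ContinuousOn (fun x => fderiv ℝ f x p) Ω := cf.clm_apply continuousOn_const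
        have c6 : ContinuousOn (fun x => fderiv ℝ f x q) Ω := cf.clm_apply continuousOn_const
        exact (c1.mul c2).mul ((c3.mul c6).sub (c4.mul c5))
      · intro x hx; simp [h0 x hx]
    have j12 := j1.sub j2
    simp only [Pi.sub_def] at j12
    have := setIntegral_congr_fun (μ := μ) hΩ.measurableSet expand
    have n2 : IntegrableOn (fun x => -(W (G x) * w x * (fderiv ℝ G x p * fderiv ℝ f x q - fderiv ℝ G x q * fderiv ℝ f x p))) Ω μ := i2.neg
    refine this.trans ?_
    rw [integral_add j12 n2, integral_sub j1 j2, integral_neg, e1, e2]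
    simp
end
end


section
open MeasureTheory Filter Topology
section
variable {E : Type*} [NormedAddCommGroup E] [NormedSpace ℝ E]

lemma line_hasDeriv {f : E → ℝ} (hf : Differentiable ℝ f) (x v : E) (t : ℝ) :
    HasDerivAt (fun s : ℝ => f (x + s • v)) (fderiv ℝ f (x + t • v) v) t := by
  have h1 : HasDerivAt (fun s : ℝ => x + s • v) v t := by
    simpa using ((hasDerivAt_id t).smul_const v).const_add x
  exact ((hf _).hasFDerivAt).comp_hasDerivAt t h1

lemma line_convex {G : E → ℝ} (hc : ConvexOn ℝ Set.univ G) (x v : E) :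
    ConvexOn ℝ Set.univ (fun s : ℝ => G (x + s • v)) := by
  refine ⟨convex_univ, fun a _ b _ s t hs ht hst => ?_⟩
  have := hc.2 (Set.mem_univ (x + a • v)) (Set.mem_univ (x + b • v)) hs ht hst
  convert this using 2
  have : x = s • x + t • x := by rw [← add_smul, hst, one_smul]
  simp only [smul_eq_mul, smul_add, add_smul, mul_smul]
  nth_rewrite 1 [this]
  abel

lemma convex_grad {G : E → ℝ} (hG : ContDiff ℝ 2 G) (hc : ConvexOn ℝ Set.univ G) (x x0 : E) :
    G x - G x0 ≤ fderiv ℝ G x (x - x0) := by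
  have h := line_hasDeriv (hG.differentiable (by norm_num)) x0 (x - x0) 1
  have := (line_convex hc x0 (x - x0)).slope_le_of_hasDerivAt (Set.mem_univ 0) (Set.mem_univ 1) one_pos h
  simpa [slope_def_field] using this

lemma convex_dd {G : E → ℝ} (hG : ContDiff ℝ 2 G) (hc : ConvexOn ℝ Set.univ G) (x v : E) :
    0 ≤ dd G x v v := by
  have hd := hG.differentiable (by norm_num)
  have hm := (line_convex hc x v).monotoneOn_deriv
    (fun t _ => (line_hasDeriv hd x v t).differentiableAt)
  have hm' : Monotone (deriv fun s : ℝ => G (x + s • v)) := fun a b hab =>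
    hm (Set.mem_univ a) (Set.mem_univ b) hab
  have e : (deriv fun s : ℝ => G (x + s • v)) = fun t => fderiv ℝ G (x + t • v) v := by
    ext t; exact (line_hasDeriv hd x v t).deriv
  have hd2 : Differentiable ℝ (fun y => fderiv ℝ G y v) :=
    ((hG.fderiv_right (m := 1) (by norm_num)).clm_apply contDiff_const).differentiable (by norm_num)
  have h2 := (line_hasDeriv hd2 x v 0).deriv
  have := hm'.deriv_nonneg (x := 0)
  rw [e, h2] at this
  rw [dd_eq isOpen_univ hG.contDiffOn (Set.mem_univ _)] at this
  simpa using this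
end

noncomputable def PP (η s : ℝ) : ℝ := max (s - η) 0 ^ 2 + max (-s - η) 0 ^ 2

lemma PP_hasDeriv (η s : ℝ) : HasDerivAt (PP η) (2 * max (s - η) 0 - 2 * max (-s - η) 0) s := by
  have h1 := (hasDerivAt_maxpow 0 (s - η)).comp s ((hasDerivAt_id s).sub_const η)
  have h2 := (hasDerivAt_maxpow 0 (-s - η)).comp s ((hasDerivAt_id s).neg.sub_const η)
  have := h1.add h2
  refine (this.congr_deriv ?_)
  simp; ring

lemma PP_cd (η : ℝ) : ContDiff ℝ 1 (PP η) := by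
  have h1 : ContDiff ℝ 1 (fun s : ℝ => max (s - η) 0 ^ 2) := contDiff_maxsq.comp (contDiff_id.sub contDiff_const)
  have h2 : ContDiff ℝ 1 (fun s : ℝ => max (-s - η) 0 ^ 2) := contDiff_maxsq.comp (contDiff_id.neg.sub contDiff_const)
  exact h1.add h2

lemma PP_sq {η : ℝ} (hη : 0 < η) (s : ℝ) : (2 * max (s - η) 0 - 2 * max (-s - η) 0) ^ 2 = 4 * PP η s := by
  unfold PP
  rcases le_total s 0 with h | h
  · rw [max_eq_right (by linarith : s - η ≤ 0)]; ring
  · rw [max_eq_right (by linarith : -s - η ≤ 0)]; ring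

lemma PP_nonneg (η s : ℝ) : 0 ≤ PP η s := by unfold PP; positivity

lemma PP_le {η : ℝ} (hη : 0 < η) (s : ℝ) : PP η s ≤ s ^ 2 := by
  unfold PP
  rcases le_total s 0 with h | h
  · rw [max_eq_right (by linarith : s - η ≤ 0)]
    have a : max (-s - η) 0 ≤ -s := max_le (by linarith) (by linarith)
    have b : 0 ≤ max (-s - η) 0 := le_max_right _ _
    nlinarith
  · rw [max_eq_right (by linarith : -s - η ≤ 0)]
    have a : max (s - η) 0 ≤ s := max_le (by linarith) (by linarith)
    have b : 0 ≤ max (s - η) 0 := le_max_right _ _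
    nlinarith

lemma PP_zero {η s : ℝ} (h : |s| < η) : PP η s = 0 := by
  obtain ⟨a, b⟩ := abs_lt.1 h
  unfold PP
  rw [max_eq_right (by linarith), max_eq_right (by linarith)]; ring

lemma PP_tendsto (s : ℝ) : Tendsto (fun m : ℕ => PP (1 / ((m:ℝ) + 1)) s) atTop (𝓝 (s ^ 2)) := by
  have h0 : Tendsto (fun m : ℕ => 1 / ((m:ℝ) + 1)) atTop (𝓝 0) := tendsto_one_div_add_atTop_nhds_zero_nat
  have hc : Continuous (fun η : ℝ => PP η s) := by unfold PP; fun_prop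
  have := (hc.tendsto 0).comp h0
  have e : PP 0 s = s ^ 2 := by
    unfold PP
    rcases le_total s 0 with h | h
    · rw [max_eq_right (by linarith : s - 0 ≤ 0), max_eq_left (by linarith)]; ring
    · rw [max_eq_left (by linarith), max_eq_right (by linarith)]; ring
  rwa [e] at this

lemma level_compact {E : Type*} [NormedAddCommGroup E] [NormedSpace ℝ E] [FiniteDimensional ℝ E]
    {Ω : Set E} (hΩ : IsOpen Ω) (hb : Bornology.IsBounded Ω) {w : E → ℝ}
    (hw : ContinuousOn w Ω) (htr : ∀ x ∈ frontier Ω, Tendsto w (𝓝[Ω] x) (𝓝 0)) {η : ℝ} (hη : 0 < η) :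
    IsCompact {x | x ∈ Ω ∧ η ≤ |w x|} := by
  have : ProperSpace E := FiniteDimensional.proper ℝ E
  apply Metric.isCompact_of_isClosed_isBounded
  · rw [← isOpen_compl_iff, isOpen_iff_mem_nhds]
    intro x hx
    by_cases hxΩ : x ∈ Ω
    · have hlt : |w x| < η := by
        by_contra h
        exact hx ⟨hxΩ, not_lt.1 h⟩
      have := ((hw.continuousAt (hΩ.mem_nhds hxΩ)).abs).eventually (Iio_mem_nhds hlt)
      filter_upwards [this] with y hy h
      exact absurd h.2 (not_le.2 hy)
    · by_cases hc : x ∈ closure Ω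
      · have hf : x ∈ frontier Ω := by rw [hΩ.frontier_eq]; exact ⟨hc, hxΩ⟩
        have := (htr x hf).abs.eventually (Iio_mem_nhds (by simpa using hη : |(0:ℝ)| < η))
        rw [eventually_nhdsWithin_iff] at this
        filter_upwards [this] with y hy h
        exact absurd h.2 (not_le.2 (hy h.1))
      · filter_upwards [isClosed_closure.isOpen_compl.mem_nhds hc] with y hy h
        exact hy (subset_closure h.1)
  · exact hb.subset (fun x hx => hx.1)

lemma euc_sum {n : ℕ} (L : EuclideanSpace ℝ (Fin n) →L[ℝ] ℝ) (v : EuclideanSpace ℝ (Fin n)) :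
    ∑ i, v i * L (EuclideanSpace.single i 1) = L v := by
  conv_rhs => rw [← (EuclideanSpace.basisFun (Fin n) ℝ).sum_repr v]
  simp

lemma strip1 {n : ℕ} {Ω : Set (EuclideanSpace ℝ (Fin n))} (hΩ : IsOpen Ω) (hb : Bornology.IsBounded Ω)
    {w G : EuclideanSpace ℝ (Fin n) → ℝ} (hw : ContDiffOn ℝ 2 w Ω)
    (htr : ∀ x ∈ frontier Ω, Tendsto w (𝓝[Ω] x) (𝓝 0)) (hw0 : ∀ x, x ∉ Ω → w x = 0)
    (hG : ContDiff ℝ 2 G) (hc : ConvexOn ℝ Set.univ G) (hG1 : ∀ x ∈ Ω, G x < 1)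
    {x0 : EuclideanSpace ℝ (Fin n)} (hx0 : G x0 = 0) {R : ℝ} (hR : ∀ x ∈ Ω, ‖x - x0‖ ≤ R)
    (hI : IntegrableOn (fun x => ‖fderiv ℝ w x‖ ^ 2) Ω)
    {c : ℝ} (hc1 : 1/2 ≤ c) {η : ℝ} (hη : 0 < η) :
    ∫ x in Ω, max (G x - c) 0 * PP η (w x) ≤ 4 * R ^ 2 * ∫ x in Ω, max (G x - c) 0 ^ 3 * ‖fderiv ℝ w x‖ ^ 2 := by
  have hK := level_compact hΩ hb hw.continuousOn htr hη
  have hKΩ : {x | x ∈ Ω ∧ η ≤ |w x|} ⊆ Ω := fun x hx => hx.1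
  have hP0 : ∀ x, x ∉ {x | x ∈ Ω ∧ η ≤ |w x|} → PP η (w x) = 0 := by
    intro x hx
    apply PP_zero
    by_cases h : x ∈ Ω
    · by_contra h2; exact hx ⟨h, not_lt.1 h2⟩
    · rw [hw0 x h]; simpa using hη
  have hw1 : ContDiffOn ℝ 1 w Ω := hw.of_le (by norm_num)
  have hGd : ContDiff ℝ 1 G := hG.of_le (by norm_num)
  let T : EuclideanSpace ℝ (Fin n) → ℝ := fun x => max (G x - c) 0 ^ 2
  have hT : ContDiff ℝ 1 T := contDiff_maxsq.comp (hGd.sub contDiff_const)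
  have hPw : ContDiffOn ℝ 1 (fun x => PP η (w x)) Ω := (PP_cd η).comp_contDiffOn hw1
  have hQ : ContDiffOn ℝ 1 (fun x => T x * PP η (w x)) Ω := hT.contDiffOn.mul hPw
  have hpr : ∀ i : Fin n, ContDiff ℝ 1 (fun x : EuclideanSpace ℝ (Fin n) => x i - x0 i) := fun i =>
    ((EuclideanSpace.proj (𝕜 := ℝ) i).contDiff).sub contDiff_const
  have hib := fun i : Fin n => ibpΩ volume hΩ hK hKΩ (f := fun x => (x i - x0 i) * (T x * PP η (w x)))
    ((hpr i).contDiffOn.mul hQ) (fun x hx => by simp [hP0 x hx]) (EuclideanSpace.single i 1)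
  have hsum : ∫ x in Ω, ∑ i : Fin n, fderiv ℝ (fun x => (x i - x0 i) * (T x * PP η (w x))) x (EuclideanSpace.single i 1) = 0 := by
    rw [integral_finsetSum _ (fun i _ => (hib i).1)]
    exact Finset.sum_eq_zero fun i _ => (hib i).2
  have hsi : IntegrableOn (fun x => ∑ i : Fin n, fderiv ℝ (fun x => (x i - x0 i) * (T x * PP η (w x))) x (EuclideanSpace.single i 1)) Ω :=
    integrable_finsetSum _ (fun i _ => (hib i).1)
  have key : ∀ x ∈ Ω, 1/2 * (max (G x - c) 0 * PP η (w x)) - 2 * R ^ 2 * (max (G x - c) 0 ^ 3 * ‖fderiv ℝ w x‖ ^ 2)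
      ≤ ∑ i : Fin n, fderiv ℝ (fun x => (x i - x0 i) * (T x * PP η (w x))) x (EuclideanSpace.single i 1) := by
    intro x hx
    have dw := cd1_diffAt hΩ hw1 hx
    have dG : DifferentiableAt ℝ G x := hGd.differentiable (by norm_num) x
    have dT := hT.differentiable (by norm_num) x
    have dPw := cd1_diffAt hΩ hPw hx
    have dQ := cd1_diffAt hΩ hQ hx
    have e1 : ∀ i : Fin n, fderiv ℝ (fun x => (x i - x0 i) * (T x * PP η (w x))) x (EuclideanSpace.single i 1)
        = (x - x0) i * fderiv ℝ (fun x => T x * PP η (w x)) x (EuclideanSpace.single i 1) + T x * PP η (w x) := by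
      intro i
      rw [fderiv_mul_apply ((hpr i).differentiable (by norm_num) x) dQ]
      have : fderiv ℝ (fun x : EuclideanSpace ℝ (Fin n) => x i - x0 i) x = EuclideanSpace.proj (𝕜 := ℝ) i := by
        rw [fderiv_sub_const]
        exact (EuclideanSpace.proj (𝕜 := ℝ) i).fderiv
      rw [this]
      simp
    have eT : fderiv ℝ T x (x - x0) = 2 * max (G x - c) 0 * fderiv ℝ G x (x - x0) := by
      have := ((hasDerivAt_maxpow 0 (G x - c)).comp_hasFDerivAt x (dG.hasFDerivAt.sub_const c)).fderiv
      have e : T = (fun t : ℝ => (max t 0) ^ (0 + 2)) ∘ (fun y => G y - c) := by ext y; simp [T]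
      rw [e, this]; simp
    have eP : fderiv ℝ (fun x => PP η (w x)) x (x - x0) = (2 * max (w x - η) 0 - 2 * max (-w x - η) 0) * fderiv ℝ w x (x - x0) := by
      have := ((PP_hasDeriv η (w x)).comp_hasFDerivAt x dw.hasFDerivAt).fderiv
      have e : (fun x => PP η (w x)) = PP η ∘ w := rfl
      rw [e, this]; simp
    simp only [e1]
    rw [Finset.sum_add_distrib, euc_sum, fderiv_mul_apply dT dPw, eT, eP]
    have hs := PP_sq hη (w x)
    have hPn := PP_nonneg η (w x)
    set P := PP η (w x)
    set P' := (2 * max (w x - η) 0 - 2 * max (-w x - η) 0)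
    have ht0 : 0 ≤ max (G x - c) 0 := le_max_right _ _
    have hTe : T x = max (G x - c) 0 ^ 2 := rfl
    rw [hTe]
    have hDG := convex_grad hG hc x x0
    have hDw : |fderiv ℝ w x (x - x0)| ≤ ‖fderiv ℝ w x‖ * R :=
      ((fderiv ℝ w x).le_opNorm _).trans (mul_le_mul_of_nonneg_left (hR x hx) (norm_nonneg _))
    have hDw2 : fderiv ℝ w x (x - x0) ^ 2 ≤ R ^ 2 * ‖fderiv ℝ w x‖ ^ 2 := by
      rw [← sq_abs]
      calc _ ≤ (‖fderiv ℝ w x‖ * R) ^ 2 := by gcongr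
        _ = _ := by ring
    set D := fderiv ℝ w x (x - x0)
    have hsum0 : 0 ≤ ∑ i : Fin n, max (G x - c) 0 ^ 2 * P := Finset.sum_nonneg fun i _ => by positivity
    rcases le_total (G x - c) 0 with h | h
    · rw [max_eq_right h] at *
      simp
    · rw [max_eq_left h] at *
      have g1 : 1/2 ≤ fderiv ℝ G x (x - x0) := by linarith
      set t := G x - c
      have a1 : t * P ≤ 2 * t * fderiv ℝ G x (x - x0) * P := by
        have : 0 ≤ t * P := by positivity
        nlinarith
      have a2 : 0 ≤ t * (P' / 2 + 2 * t * D) ^ 2 := by positivity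
      have a3 : t ^ 3 * D ^ 2 ≤ t ^ 3 * (R ^ 2 * ‖fderiv ℝ w x‖ ^ 2) := by gcongr
      have a4 : t * P' ^ 2 = 4 * (t * P) := by rw [hs]; ring
      nlinarith
  have cG : ContinuousOn (fun x => max (G x - c) 0) Ω := (hG.continuous.sub continuous_const).continuousOn.sup continuousOn_const
  have iA : IntegrableOn (fun x => max (G x - c) 0 * PP η (w x)) Ω := by
    apply int_of_cont volume hΩ hK hKΩ
    · exact cG.mul hPw.continuousOn
    · intro x hx; simp [hP0 x hx]
  have iB : IntegrableOn (fun x => max (G x - c) 0 ^ 3 * ‖fderiv ℝ w x‖ ^ 2) Ω := by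
    apply hI.bdd_mul (c := |1 - c| ^ 3)
    · exact (cG.pow 3).aestronglyMeasurable hΩ.measurableSet
    · filter_upwards [ae_restrict_mem hΩ.measurableSet] with x hx
      rw [Real.norm_eq_abs, abs_pow]
      have h1 : |max (G x - c) 0| ≤ |1 - c| := by
        rw [abs_of_nonneg (le_max_right _ _)]
        exact max_le (by linarith [hG1 x hx, le_abs_self (1 - c)]) (abs_nonneg _)
      gcongr
  have fin := setIntegral_mono_on ((iA.const_mul (1/2)).sub (iB.const_mul (2 * R ^ 2))) hsi hΩ.measurableSet key
  rw [hsum] at fin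
  simp only [Pi.sub_apply] at fin
  rw [integral_sub (iA.const_mul (1/2)) (iB.const_mul (2 * R ^ 2)), integral_const_mul, integral_const_mul] at fin
  linarith

lemma strip2 {n : ℕ} {Ω : Set (EuclideanSpace ℝ (Fin n))} (hΩ : IsOpen Ω) (hb : Bornology.IsBounded Ω)
    {w G : EuclideanSpace ℝ (Fin n) → ℝ} (hw : ContDiffOn ℝ 2 w Ω)
    (htr : ∀ x ∈ frontier Ω, Tendsto w (𝓝[Ω] x) (𝓝 0)) (hw0 : ∀ x, x ∉ Ω → w x = 0)
    (hG : ContDiff ℝ 2 G) (hc : ConvexOn ℝ Set.univ G) (hG1 : ∀ x ∈ Ω, G x < 1)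
    {x0 : EuclideanSpace ℝ (Fin n)} (hx0 : G x0 = 0) {R : ℝ} (hR : ∀ x ∈ Ω, ‖x - x0‖ ≤ R)
    (hI0 : IntegrableOn (fun x => w x ^ 2) Ω)
    (hI : IntegrableOn (fun x => ‖fderiv ℝ w x‖ ^ 2) Ω)
    {c : ℝ} (hc1 : 1/2 ≤ c) :
    ∫ x in Ω, max (G x - c) 0 * w x ^ 2 ≤ 4 * R ^ 2 * ∫ x in Ω, max (G x - c) 0 ^ 3 * ‖fderiv ℝ w x‖ ^ 2 := by
  have cG : ContinuousOn (fun x => max (G x - c) 0) Ω := (hG.continuous.sub continuous_const).continuousOn.sup continuousOn_const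
  have hw1 : ContDiffOn ℝ 1 w Ω := hw.of_le (by norm_num)
  have hl : Tendsto (fun m : ℕ => ∫ x in Ω, max (G x - c) 0 * PP (1 / ((m:ℝ) + 1)) (w x)) atTop
      (𝓝 (∫ x in Ω, max (G x - c) 0 * w x ^ 2)) := by
    apply tendsto_integral_of_dominated_convergence (fun x => |1 - c| * w x ^ 2)
    · intro m
      have hPw : ContDiffOn ℝ 1 (fun x => PP (1 / ((m:ℝ) + 1)) (w x)) Ω := (PP_cd _).comp_contDiffOn hw1
      exact (cG.mul hPw.continuousOn).aestronglyMeasurable hΩ.measurableSet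
    · exact hI0.const_mul _
    · intro m
      filter_upwards [ae_restrict_mem hΩ.measurableSet] with x hx
      have h0 := PP_nonneg (1 / ((m:ℝ) + 1)) (w x)
      have h1 := PP_le (by positivity : 0 < 1 / ((m:ℝ) + 1)) (w x)
      have h2 : max (G x - c) 0 ≤ |1 - c| :=
        max_le (by linarith [hG1 x hx, le_abs_self (1 - c)]) (abs_nonneg _)
      have h3 : 0 ≤ max (G x - c) 0 := le_max_right _ _
      rw [Real.norm_eq_abs, abs_of_nonneg (by positivity)]
      gcongr
    · filter_upwards with x
      exact (PP_tendsto (w x)).const_mul _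
  exact le_of_tendsto' hl fun m => strip1 hΩ hb hw htr hw0 hG hc hG1 hx0 hR hI hc1 (by positivity)

lemma strip {n : ℕ} {Ω : Set (EuclideanSpace ℝ (Fin n))} (hΩ : IsOpen Ω) (hb : Bornology.IsBounded Ω)
    {w G : EuclideanSpace ℝ (Fin n) → ℝ} (hw : ContDiffOn ℝ 2 w Ω)
    (htr : ∀ x ∈ frontier Ω, Tendsto w (𝓝[Ω] x) (𝓝 0))
    (hG : ContDiff ℝ 2 G) (hc : ConvexOn ℝ Set.univ G) (hG1 : ∀ x ∈ Ω, G x < 1)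
    {x0 : EuclideanSpace ℝ (Fin n)} (hx0 : G x0 = 0) {R : ℝ} (hR : ∀ x ∈ Ω, ‖x - x0‖ ≤ R)
    (hI0 : IntegrableOn (fun x => w x ^ 2) Ω)
    (hI : IntegrableOn (fun x => ‖fderiv ℝ w x‖ ^ 2) Ω)
    {c : ℝ} (hc1 : 1/2 ≤ c) :
    ∫ x in Ω, max (G x - c) 0 * w x ^ 2 ≤ 4 * R ^ 2 * ∫ x in Ω, max (G x - c) 0 ^ 3 * ‖fderiv ℝ w x‖ ^ 2 := by
  let w' := Ω.indicator w
  have he : ∀ x ∈ Ω, w' x = w x := fun x hx => Set.indicator_of_mem hx w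
  have hd : ∀ x ∈ Ω, fderiv ℝ w' x = fderiv ℝ w x := by
    intro x hx
    apply Filter.EventuallyEq.fderiv_eq
    filter_upwards [hΩ.mem_nhds hx] with y hy using he y hy
  have := strip2 (w := w') hΩ hb (hw.congr he)
    (fun x hx => (htr x hx).congr' (by
      filter_upwards [self_mem_nhdsWithin] with y hy using (he y hy).symm))
    (fun x hx => Set.indicator_of_notMem hx w) hG hc hG1 hx0 hR
    (hI0.congr_fun (fun x hx => by simp only [he x hx]) hΩ.measurableSet)
    (hI.congr_fun (fun x hx => by simp only [hd x hx]) hΩ.measurableSet) hc1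
  rw [setIntegral_congr_fun hΩ.measurableSet (g := fun x => max (G x - c) 0 * w x ^ 2) (fun x hx => by simp only [he x hx]),
    setIntegral_congr_fun hΩ.measurableSet (f := fun x => max (G x - c) 0 ^ 3 * ‖fderiv ℝ w' x‖ ^ 2) (g := fun x => max (G x - c) 0 ^ 3 * ‖fderiv ℝ w x‖ ^ 2) (fun x hx => by simp only [hd x hx])] at this
  exact this
end


section
open MeasureTheory Filter Topology

lemma S_facts : ∃ (S1 S2 : ℝ → ℝ) (C : ℝ), 0 ≤ C ∧ (∀ s, HasDerivAt Real.smoothTransition (S1 s) s) ∧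
    (∀ s, HasDerivAt S1 (S2 s) s) ∧ (∀ s, 0 ≤ S1 s) ∧ (∀ s, S1 s ≤ C) ∧ (∀ s, |S2 s| ≤ C) ∧
    (∀ s, s < 0 → S1 s = 0 ∧ S2 s = 0) ∧ (∀ s, 1 < s → S1 s = 0 ∧ S2 s = 0) := by
  have hS : ContDiff ℝ 2 Real.smoothTransition := Real.smoothTransition.contDiff
  have h1 : ContDiff ℝ 1 (deriv Real.smoothTransition) := by
    have : ContDiff ℝ (1 + 1) Real.smoothTransition := by norm_num; exact hS
    exact (contDiff_succ_iff_deriv.1 this).2.2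
  have c1 : Continuous (deriv Real.smoothTransition) := h1.continuous
  have c2 : Continuous (deriv (deriv Real.smoothTransition)) := h1.continuous_deriv (by norm_num)
  have z0 : ∀ s : ℝ, s < 0 → deriv Real.smoothTransition s = 0 := by
    intro s hs
    have : Real.smoothTransition =ᶠ[𝓝 s] fun _ => 0 := by
      filter_upwards [Iio_mem_nhds hs] with t ht
      exact Real.smoothTransition.zero_of_nonpos (le_of_lt ht)
    rw [this.deriv_eq]; simp
  have z1 : ∀ s : ℝ, 1 < s → deriv Real.smoothTransition s = 0 := by
    intro s hs
    have : Real.smoothTransition =ᶠ[𝓝 s] fun _ => 1 := by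
      filter_upwards [Ioi_mem_nhds hs] with t ht
      exact Real.smoothTransition.one_of_one_le (le_of_lt ht)
    rw [this.deriv_eq]; simp
  have y0 : ∀ s : ℝ, s < 0 → deriv (deriv Real.smoothTransition) s = 0 := by
    intro s hs
    have : deriv Real.smoothTransition =ᶠ[𝓝 s] fun _ => 0 := by
      filter_upwards [Iio_mem_nhds hs] with t ht
      exact z0 t ht
    rw [this.deriv_eq]; simp
  have y1 : ∀ s : ℝ, 1 < s → deriv (deriv Real.smoothTransition) s = 0 := by
    intro s hs
    have : deriv Real.smoothTransition =ᶠ[𝓝 s] fun _ => 0 := by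
      filter_upwards [Ioi_mem_nhds hs] with t ht
      exact z1 t ht
    rw [this.deriv_eq]; simp
  obtain ⟨C1, hC1⟩ := (isCompact_Icc (a := (0:ℝ)) (b := 1)).exists_bound_of_continuousOn c1.continuousOn
  obtain ⟨C2, hC2⟩ := (isCompact_Icc (a := (0:ℝ)) (b := 1)).exists_bound_of_continuousOn c2.continuousOn
  refine ⟨deriv Real.smoothTransition, deriv (deriv Real.smoothTransition), |C1| + |C2|, by positivity,
    fun s => (hS.differentiable (by norm_num) s).hasDerivAt, fun s => (h1.differentiable (by norm_num) s).hasDerivAt,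
    fun s => Real.smoothTransition.monotone.deriv_nonneg, ?_, ?_, fun s hs => ⟨z0 s hs, y0 s hs⟩,
    fun s hs => ⟨z1 s hs, y1 s hs⟩⟩
  · intro s
    rcases lt_or_ge s 0 with h | h
    · rw [z0 s h]; positivity
    rcases lt_or_ge 1 s with h' | h'
    · rw [z1 s h']; positivity
    have := hC1 s ⟨h, h'⟩
    rw [Real.norm_eq_abs] at this
    linarith [le_abs_self (deriv Real.smoothTransition s), le_abs_self C1, abs_nonneg C2]
  · intro s
    rcases lt_or_ge s 0 with h | h
    · rw [y0 s h, abs_zero]; positivity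
    rcases lt_or_ge 1 s with h' | h'
    · rw [y1 s h', abs_zero]; positivity
    have := hC2 s ⟨h, h'⟩
    rw [Real.norm_eq_abs] at this
    linarith [le_abs_self C2, abs_nonneg C1]

lemma exists_chi : ∃ C : ℝ, 0 ≤ C ∧ ∀ k δ : ℝ, 0 < k → 0 < δ → ∃ χ χ1 χ2 : ℝ → ℝ, ContDiff ℝ 2 χ ∧
    (∀ s, HasDerivAt χ (χ1 s) s) ∧ (∀ s, HasDerivAt χ1 (χ2 s) s) ∧
    (∀ s, s ≤ δ → χ s = 0) ∧ (∀ s, 2 * δ ≤ s → χ s = 1 - Real.exp (-(k * s))) ∧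
    (∀ s, 0 ≤ s → 0 ≤ χ s ∧ χ s ≤ 1 ∧ 0 ≤ χ1 s) ∧
    (∀ s, δ ≤ s → s ≤ 2 * δ → χ2 s ≤ C * k / δ) ∧
    (∀ s, 0 ≤ s → ¬ (δ ≤ s ∧ s ≤ 2 * δ) → χ2 s ≤ 0) := by
  obtain ⟨S1, S2, C, hC, hd1, hd2, hn, hb1, hb2, hz0, hz1⟩ := S_facts
  refine ⟨4 * C, by positivity, fun k δ hk hδ => ?_⟩
  have ha : ∀ s : ℝ, HasDerivAt (fun s : ℝ => s / δ - 1) (1 / δ) s := fun s =>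
    ((hasDerivAt_id s).div_const δ).sub_const 1
  have he : ∀ s : ℝ, HasDerivAt (fun s : ℝ => Real.exp (-(k * s))) (-(k * Real.exp (-(k * s)))) s := by
    intro s
    have := ((hasDerivAt_id s).const_mul k).neg.exp
    refine this.congr_deriv ?_
    simp; ring
  have hS : ∀ s : ℝ, HasDerivAt (fun s : ℝ => Real.smoothTransition (s / δ - 1)) (S1 (s / δ - 1) * (1 / δ)) s :=
    fun s => (hd1 _).comp s (ha s)
  have hS1 : ∀ s : ℝ, HasDerivAt (fun s : ℝ => S1 (s / δ - 1)) (S2 (s / δ - 1) * (1 / δ)) s :=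
    fun s => (hd2 _).comp s (ha s)
  have eneg : ∀ s : ℝ, 0 < s → s ≤ δ → s / δ - 1 ≤ 0 := fun s _ h => by
    rw [sub_nonpos, div_le_one hδ]; exact h
  refine ⟨fun s => Real.smoothTransition (s / δ - 1) * (1 - Real.exp (-(k * s))),
    fun s => S1 (s / δ - 1) * (1 / δ) * (1 - Real.exp (-(k * s))) + Real.smoothTransition (s / δ - 1) * (k * Real.exp (-(k * s))),
    fun s => S2 (s / δ - 1) * (1 / δ) * (1 / δ) * (1 - Real.exp (-(k * s))) + 2 * (S1 (s / δ - 1) * (1 / δ)) * (k * Real.exp (-(k * s)))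
      - Real.smoothTransition (s / δ - 1) * (k * (k * Real.exp (-(k * s)))), ?_, ?_, ?_, ?_, ?_, ?_, ?_, ?_⟩
  · have h1 : ContDiff ℝ 2 (fun s : ℝ => Real.smoothTransition (s / δ - 1)) :=
      Real.smoothTransition.contDiff.comp ((contDiff_id.div_const δ).sub contDiff_const)
    have h2 : ContDiff ℝ 2 (fun s : ℝ => Real.exp (-(k * s))) :=
      Real.contDiff_exp.comp (contDiff_const.mul contDiff_id).neg
    exact h1.mul (contDiff_const.sub h2)
  · intro s
    refine ((hS s).mul ((he s).const_sub 1)).congr_deriv ?_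
    ring
  · intro s
    refine ((((hS1 s).mul_const (1/δ)).mul ((he s).const_sub 1)).add ((hS s).mul ((he s).const_mul k))).congr_deriv ?_
    ring
  · intro s hs
    simp only
    rw [Real.smoothTransition.zero_of_nonpos (by rw [sub_nonpos, div_le_one hδ]; exact hs), zero_mul]
  · intro s hs
    simp only
    rw [Real.smoothTransition.one_of_one_le (by rw [le_sub_iff_add_le, le_div_iff₀ hδ]; linarith), one_mul]
  · intro s hs
    have p1 := Real.smoothTransition.nonneg (s / δ - 1)
    have p2 := Real.smoothTransition.le_one (s / δ - 1)
    have p3 : Real.exp (-(k * s)) ≤ 1 := by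
      rw [Real.exp_le_one_iff]; have : 0 ≤ k * s := by positivity
      linarith
    have p4 := Real.exp_pos (-(k * s))
    have p5 : 0 ≤ 1 - Real.exp (-(k * s)) := by linarith
    have p6 := hn (s / δ - 1)
    refine ⟨by positivity, ?_, by positivity⟩
    nlinarith
  · intro s h1 h2
    have hs : 0 < s := lt_of_lt_of_le hδ h1
    have p1 := Real.smoothTransition.nonneg (s / δ - 1)
    have p3 : Real.exp (-(k * s)) ≤ 1 := by
      rw [Real.exp_le_one_iff]; have : 0 ≤ k * s := by positivity
      linarith
    have p4 := Real.exp_pos (-(k * s))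
    have p5 : 0 ≤ 1 - Real.exp (-(k * s)) := by linarith
    have p7 : 1 - Real.exp (-(k * s)) ≤ 2 * k * δ := by
      have := Real.add_one_le_exp (-(k * s))
      nlinarith
    have p6 := hn (s / δ - 1)
    have q1 : S2 (s / δ - 1) * (1 / δ) * (1 / δ) * (1 - Real.exp (-(k * s))) ≤ C * (1 / δ) * (1 / δ) * (2 * k * δ) := by
      have : S2 (s / δ - 1) ≤ C := (le_abs_self _).trans (hb2 _)
      calc _ ≤ C * (1 / δ) * (1 / δ) * (1 - Real.exp (-(k * s))) := by gcongr
        _ ≤ _ := by gcongr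
    have q2 : 2 * (S1 (s / δ - 1) * (1 / δ)) * (k * Real.exp (-(k * s))) ≤ 2 * (C * (1 / δ)) * (k * 1) := by
      have := hb1 (s / δ - 1)
      gcongr
    have q3 : 0 ≤ Real.smoothTransition (s / δ - 1) * (k * (k * Real.exp (-(k * s)))) := by positivity
    have q4 : C * (1 / δ) * (1 / δ) * (2 * k * δ) + 2 * (C * (1 / δ)) * (k * 1) = 4 * C * k / δ := by
      field_simp; ring
    linarith
  · intro s hs hns
    have p1 := Real.smoothTransition.nonneg (s / δ - 1)
    have p4 := Real.exp_pos (-(k * s))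
    have q3 : 0 ≤ Real.smoothTransition (s / δ - 1) * (k * (k * Real.exp (-(k * s)))) := by positivity
    have : S1 (s / δ - 1) = 0 ∧ S2 (s / δ - 1) = 0 := by
      rcases lt_or_ge s δ with h | h
      · apply hz0; rw [sub_neg, div_lt_one hδ]; exact h
      · have : 2 * δ < s := by
          by_contra h'; exact hns ⟨h, not_lt.1 h'⟩
        apply hz1; rw [lt_sub_iff_add_lt, lt_div_iff₀ hδ]; linarith
    simp only [this.1, this.2]
    linarith

lemma exists_W (δ : ℝ) (hδ : 0 < δ) : ∃ W : ℝ → ℝ, ContDiff ℝ 1 W ∧ (∀ g, 0 ≤ W g ∧ W g ≤ 1) ∧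
    (∀ g, 1 - δ / 2 ≤ g → W g = 0) ∧ (∀ g, g ≤ 1 - 3 * δ → W g = 0) ∧
    (∀ g, δ ≤ 1 - g → 1 - g ≤ 2 * δ → W g = 1) := by
  refine ⟨fun g => Real.smoothTransition (2 * (1 - g) / δ - 1) * Real.smoothTransition (3 - (1 - g) / δ), ?_, ?_, ?_, ?_, ?_⟩
  · have h1 : ContDiff ℝ 1 (fun g : ℝ => Real.smoothTransition (2 * (1 - g) / δ - 1)) :=
      Real.smoothTransition.contDiff.comp (by fun_prop)
    have h2 : ContDiff ℝ 1 (fun g : ℝ => Real.smoothTransition (3 - (1 - g) / δ)) :=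
      Real.smoothTransition.contDiff.comp (by fun_prop)
    exact h1.mul h2
  · intro g
    have a := Real.smoothTransition.nonneg (2 * (1 - g) / δ - 1)
    have b := Real.smoothTransition.le_one (2 * (1 - g) / δ - 1)
    have c := Real.smoothTransition.nonneg (3 - (1 - g) / δ)
    have d := Real.smoothTransition.le_one (3 - (1 - g) / δ)
    exact ⟨by positivity, by nlinarith⟩
  · intro g hg
    simp only
    rw [Real.smoothTransition.zero_of_nonpos (by rw [sub_nonpos, div_le_one hδ]; linarith), zero_mul]
  · intro g hg
    simp only
    rw [Real.smoothTransition.zero_of_nonpos (x := 3 - (1 - g) / δ) (by rw [sub_nonpos, le_div_iff₀ hδ]; linarith), mul_zero]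
  · intro g h1 h2
    simp only
    rw [Real.smoothTransition.one_of_one_le (by rw [le_sub_iff_add_le, le_div_iff₀ hδ]; linarith),
      Real.smoothTransition.one_of_one_le (x := 3 - (1 - g) / δ) (by rw [le_sub_iff_add_le, ← le_sub_iff_add_le', div_le_iff₀ hδ]; linarith), mul_one]
end


section
open MeasureTheory Filter Topology

section
variable {E : Type*} [NormedAddCommGroup E] [NormedSpace ℝ E]

lemma phi_derivs {G : E → ℝ} (hG : ContDiff ℝ 2 G) {χ χ1 χ2 : ℝ → ℝ}
    (h1 : ∀ s, HasDerivAt χ (χ1 s) s) (h2 : ∀ s, HasDerivAt χ1 (χ2 s) s)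
    (hφ : ContDiff ℝ 2 (fun x => χ (1 - G x))) (x p q : E) :
    dd (fun x => χ (1 - G x)) x p q
      = χ2 (1 - G x) * fderiv ℝ G x p * fderiv ℝ G x q - χ1 (1 - G x) * dd G x p q := by
  have hd : Differentiable ℝ G := hG.differentiable (by norm_num)
  have e1 : ∀ y r, fderiv ℝ (fun x => χ (1 - G x)) y r = (-χ1 (1 - G y)) * fderiv ℝ G y r := by
    intro y r
    have := ((h1 (1 - G y)).comp_hasFDerivAt y ((hd y).hasFDerivAt.const_sub 1)).fderiv
    have e : (fun x => χ (1 - G x)) = χ ∘ (fun x => 1 - G x) := rfl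
    rw [e, this]; simp
  have h3 := (h2 (1 - G x)).comp_hasFDerivAt x ((hd x).hasFDerivAt.const_sub 1)
  have e3 : fderiv ℝ (fun y => -χ1 (1 - G y)) x p = χ2 (1 - G x) * fderiv ℝ G x p := by
    have := h3.neg.fderiv
    have e : (fun y => -χ1 (1 - G y)) = -(χ1 ∘ (fun x => 1 - G x)) := rfl
    rw [e, this]; simp
  have d3 : DifferentiableAt ℝ (fun y => -χ1 (1 - G y)) x := h3.neg.differentiableAt
  rw [← dd_eq isOpen_univ hφ.contDiffOn (Set.mem_univ x)]
  simp only [e1]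
  rw [fderiv_mul_apply d3 (cd1_diffAt isOpen_univ (fderiv_cd1' isOpen_univ hG.contDiffOn q) (Set.mem_univ x)), e3,
    dd_eq isOpen_univ hG.contDiffOn (Set.mem_univ x)]
  ring

lemma dd_le (w : E → ℝ) (x p q : E) : |dd w x p q| ≤ ‖fderiv ℝ (fderiv ℝ w) x‖ * ‖p‖ * ‖q‖ := by
  unfold dd
  exact (fderiv ℝ (fderiv ℝ w) x).le_opNorm₂ p q

lemma tri {a b x y z : ℝ} (hx : |x| ≤ b) (hy : |y| ≤ b) (hz : |z| ≤ a) : |x * (y * z)| ≤ b ^ 2 * a := by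
  have hb : 0 ≤ b := (abs_nonneg _).trans hx
  rw [abs_mul, abs_mul]
  calc |x| * (|y| * |z|) ≤ b * (b * a) := by gcongr
    _ = _ := by ring

lemma dd_quad (G : E → ℝ) (x p q : E) (a b : ℝ) :
    dd G x (a • p - b • q) (a • p - b • q) = a ^ 2 * dd G x p p - a * b * (dd G x p q + dd G x q p) + b ^ 2 * dd G x q q := by
  unfold dd
  simp only [map_sub, map_smul, sub_apply, smul_apply, smul_eq_mul]
  ring
end

set_option maxHeartbeats 2000000 in
lemma core1 {n : ℕ} {Ω : Set (EuclideanSpace ℝ (Fin n))} (hΩ : IsOpen Ω) (hb : Bornology.IsBounded Ω)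
    {w G : EuclideanSpace ℝ (Fin n) → ℝ} (hw : ContDiffOn ℝ 2 w Ω)
    (htr : ∀ x ∈ frontier Ω, Tendsto w (𝓝[Ω] x) (𝓝 0))
    (hG : ContDiff ℝ 2 G) (hc : ConvexOn ℝ Set.univ G) (hGΩ : Ω = {x | G x < 1})
    {x0 : EuclideanSpace ℝ (Fin n)} (hx0 : G x0 = 0)
    (hI0 : IntegrableOn (fun x => w x ^ 2) Ω)
    (hI1 : IntegrableOn (fun x => ‖fderiv ℝ w x‖ ^ 2) Ω)
    (hI2 : IntegrableOn (fun x => ‖fderiv ℝ (fderiv ℝ w) x‖ ^ 2) Ω)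
    (p q : EuclideanSpace ℝ (Fin n)) :
    ∃ C : ℝ, ∀ k δ : ℝ, 0 < k → 0 < δ → δ ≤ 1/12 → ∃ φ : EuclideanSpace ℝ (Fin n) → ℝ,
      Continuous φ ∧ (∀ x ∈ Ω, 0 ≤ φ x ∧ φ x ≤ 1) ∧
      (∀ x, 2 * δ ≤ 1 - G x → φ x = 1 - Real.exp (-(k * (1 - G x)))) ∧
      - ∫ x in Ω, φ x * (dd w x p p * dd w x q q - dd w x p q ^ 2) ≤
        k * C * ∫ x in Ω, Set.indicator {x | 1 - 6 * δ < G x}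
          (fun x => ‖fderiv ℝ w x‖ ^ 2 + ‖fderiv ℝ (fderiv ℝ w) x‖ ^ 2) x := by
  obtain ⟨Cχ, hCχ, hchi⟩ := exists_chi
  have hlt : ∀ x ∈ Ω, G x < 1 := fun x hx => by rw [hGΩ] at hx; exact hx
  have hmem : ∀ x, G x < 1 → x ∈ Ω := fun x hx => by rw [hGΩ]; exact hx
  obtain ⟨R, hR⟩ : ∃ R, ∀ x ∈ Ω, ‖x - x0‖ ≤ R := by
    obtain ⟨R, hR⟩ := hb.exists_norm_le
    exact ⟨R + ‖x0‖, fun x hx => (norm_sub_le _ _).trans (by linarith [hR x hx])⟩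
  have hcl : IsCompact (closure Ω) := hb.isCompact_closure
  have hGp : ∀ r, Continuous fun x => fderiv ℝ G x r := fun r =>
    (hG.continuous_fderiv (by norm_num)).clm_apply continuous_const
  have hGd : ∀ r s, Continuous fun x => dd G x r s := fun r s =>
    continuousOn_univ.1 (dd_cont isOpen_univ hG.contDiffOn r s)
  obtain ⟨b, hbd⟩ : ∃ b, ∀ x ∈ Ω, |fderiv ℝ G x p| ≤ b ∧ |fderiv ℝ G x q| ≤ b ∧ |dd G x p p| ≤ b ∧
      |dd G x p q| ≤ b ∧ |dd G x q p| ≤ b ∧ |dd G x q q| ≤ b := by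
    obtain ⟨b, hb'⟩ := hcl.exists_bound_of_continuousOn (f := fun x => |fderiv ℝ G x p| + |fderiv ℝ G x q| + |dd G x p p| +
      |dd G x p q| + |dd G x q p| + |dd G x q q|) (by
        have a1 := hGp p
        have a2 := hGp q
        have a3 := hGd p p
        have a4 := hGd p q
        have a5 := hGd q p
        have a6 := hGd q q
        fun_prop)
    refine ⟨b, fun x hx => ?_⟩
    have := (le_abs_self _).trans (hb' x (subset_closure hx))
    have a1 := abs_nonneg (fderiv ℝ G x p)
    have a2 := abs_nonneg (fderiv ℝ G x q)
    have a3 := abs_nonneg (dd G x p p)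
    have a4 := abs_nonneg (dd G x p q)
    have a5 := abs_nonneg (dd G x q p)
    have a6 := abs_nonneg (dd G x q q)
    refine ⟨?_, ?_, ?_, ?_, ?_, ?_⟩ <;> linarith
  let L : ℝ := (1 + ‖p‖ + ‖q‖) ^ 2
  let CR : ℝ := 128 * b ^ 4 * L ^ 2
  refine ⟨Cχ / 2 * (144 * R ^ 2 + CR / 2), fun k δ hk hδ hδ' => ?_⟩
  obtain ⟨χ, χ1, χ2, hχ, hχ1, hχ2, hχ0, hχe, hχb, hχ2a, hχ2b⟩ := hchi k δ hk hδ
  obtain ⟨W, hW, hWb, hW0, hW0', hW1⟩ := exists_W δ hδ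
  have hφ : ContDiff ℝ 2 (fun x => χ (1 - G x)) := hχ.comp (contDiff_const.sub hG)
  refine ⟨fun x => χ (1 - G x), hφ.continuous, fun x hx => ?_, fun x hx => hχe _ hx, ?_⟩
  · have := hχb (1 - G x) (by linarith [hlt x hx])
    exact ⟨this.1, this.2.1⟩
  have hK : IsCompact {x | G x ≤ 1 - δ / 2} := by
    apply Metric.isCompact_of_isClosed_isBounded
    · exact isClosed_le hG.continuous continuous_const
    · exact hb.subset (fun x hx => hmem x (by have := Set.mem_ofPred.1 hx; linarith))
  have hKΩ : {x | G x ≤ 1 - δ / 2} ⊆ Ω := fun x hx => hmem x (by have := Set.mem_ofPred.1 hx; linarith)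
  have hnK : ∀ x, x ∉ {x | G x ≤ 1 - δ / 2} → 1 - δ / 2 < G x := fun x hx => not_le.1 hx
  have hφ0 : ∀ x, x ∉ {x | G x ≤ 1 - δ / 2} → χ (1 - G x) = 0 := fun x hx =>
    hχ0 _ (by linarith [hnK x hx])
  have hWG0 : ∀ x, x ∉ {x | G x ≤ 1 - δ / 2} → W (G x) = 0 := fun x hx =>
    hW0 _ (hnK x hx).le
  have NL := nullLag volume hΩ hK hKΩ hw hφ hφ0 p q
  obtain ⟨iT, Rf, hRf, iR, eT⟩ := tang volume hΩ hK hKΩ hw hG hW hWG0 p q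
  have cdet : ContinuousOn (fun x => dd w x p p * dd w x q q - dd w x p q ^ 2) Ω :=
    ((dd_cont hΩ hw p p).mul (dd_cont hΩ hw q q)).sub ((dd_cont hΩ hw p q).pow 2)
  have iD : IntegrableOn (fun x => χ (1 - G x) * (dd w x p p * dd w x q q - dd w x p q ^ 2)) Ω := by
    apply int_of_cont volume hΩ hK hKΩ
    · exact hφ.continuous.continuousOn.mul cdet
    · intro x hx; simp [hφ0 x hx]
  -- step one
  have step1 : - ∫ x in Ω, χ (1 - G x) * (dd w x p p * dd w x q q - dd w x p q ^ 2) ≤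
      Cχ * k / (2 * δ) * ∫ x in Ω, W (G x) * (fderiv ℝ G x p * fderiv ℝ w x q - fderiv ℝ G x q * fderiv ℝ w x p) ^ 2 := by
    have hle : ∀ x ∈ Ω, χ (1 - G x) * (dd w x p p * dd w x q q - dd w x p q ^ 2)
      + 1/2 * (dd (fun x => χ (1 - G x)) x p p * fderiv ℝ w x q ^ 2 - 2 * dd (fun x => χ (1 - G x)) x p q * fderiv ℝ w x p * fderiv ℝ w x q
        + dd (fun x => χ (1 - G x)) x q q * fderiv ℝ w x p ^ 2) ≤
      χ (1 - G x) * (dd w x p p * dd w x q q - dd w x p q ^ 2) +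
      Cχ * k / (2 * δ) * (W (G x) * (fderiv ℝ G x p * fderiv ℝ w x q - fderiv ℝ G x q * fderiv ℝ w x p) ^ 2) := by
      intro x hx
      simp only [phi_derivs hG hχ1 hχ2 hφ]
      have hd0 : 0 ≤ 1 - G x := by linarith [hlt x hx]
      have hX := convex_dd hG hc x (fderiv ℝ w x q • p - fderiv ℝ w x p • q)
      rw [dd_quad, dd_symm isOpen_univ hG.contDiffOn (Set.mem_univ x) q p] at hX
      have hX' := mul_nonneg (hχb _ hd0).2.2 hX
      have hkey : χ2 (1 - G x) * (fderiv ℝ G x p * fderiv ℝ w x q - fderiv ℝ G x q * fderiv ℝ w x p) ^ 2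
          ≤ Cχ * k / δ * (W (G x) * (fderiv ℝ G x p * fderiv ℝ w x q - fderiv ℝ G x q * fderiv ℝ w x p) ^ 2) := by
        have hsq := sq_nonneg (fderiv ℝ G x p * fderiv ℝ w x q - fderiv ℝ G x q * fderiv ℝ w x p)
        by_cases h : δ ≤ 1 - G x ∧ 1 - G x ≤ 2 * δ
        · rw [hW1 _ h.1 h.2, one_mul]
          exact mul_le_mul_of_nonneg_right (hχ2a _ h.1 h.2) hsq
        · have h1 := hχ2b _ hd0 h
          have h2 := (hWb (G x)).1
          have : 0 ≤ Cχ * k / δ * (W (G x) * (fderiv ℝ G x p * fderiv ℝ w x q - fderiv ℝ G x q * fderiv ℝ w x p) ^ 2) := by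
            positivity
          nlinarith
      have e : Cχ * k / (2 * δ) * (W (G x) * (fderiv ℝ G x p * fderiv ℝ w x q - fderiv ℝ G x q * fderiv ℝ w x p) ^ 2)
        = 1/2 * (Cχ * k / δ * (W (G x) * (fderiv ℝ G x p * fderiv ℝ w x q - fderiv ℝ G x q * fderiv ℝ w x p) ^ 2)) := by
        field_simp
      rw [e]
      nlinarith
    have iN : IntegrableOn (fun x => χ (1 - G x) * (dd w x p p * dd w x q q - dd w x p q ^ 2)
      + 1/2 * (dd (fun x => χ (1 - G x)) x p p * fderiv ℝ w x q ^ 2 - 2 * dd (fun x => χ (1 - G x)) x p q * fderiv ℝ w x p * fderiv ℝ w x q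
        + dd (fun x => χ (1 - G x)) x q q * fderiv ℝ w x p ^ 2)) Ω := by
      apply int_of_cont volume hΩ hK hKΩ
      · have c1 := hφ.continuous.continuousOn.mul cdet
        have c2 := dd_cont hΩ hφ.contDiffOn p p
        have c3 := dd_cont hΩ hφ.contDiffOn p q
        have c4 := dd_cont hΩ hφ.contDiffOn q q
        have c5 := (fderiv_cd1' hΩ hw p).continuousOn
        have c6 := (fderiv_cd1' hΩ hw q).continuousOn
        exact c1.add (continuousOn_const.mul (((c2.mul (c6.pow 2)).sub (((continuousOn_const.mul c3).mul c5).mul c6)).add (c4.mul (c5.pow 2))))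
      · intro x hx
        simp [hφ0 x hx, dd_zero_off hK hφ0 x hx]
    have := setIntegral_mono_on iN (iD.add (iT.const_mul (Cχ * k / (2 * δ)))) hΩ.measurableSet hle
    rw [NL] at this
    simp only [Pi.add_apply] at this
    rw [integral_add iD (iT.const_mul (Cχ * k / (2 * δ))), integral_const_mul] at this
    linarith
  -- step two
  have hst := strip hΩ hb hw htr hG hc hlt hx0 hR hI0 hI1 (c := 1 - 6 * δ) (by linarith)
  let U : EuclideanSpace ℝ (Fin n) → ℝ := fun x => ‖fderiv ℝ w x‖ ^ 2 + ‖fderiv ℝ (fderiv ℝ w) x‖ ^ 2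
  have iU : IntegrableOn U Ω := hI1.add hI2
  have hms : MeasurableSet {x | 1 - 6 * δ < G x} := (isOpen_lt continuous_const hG.continuous).measurableSet
  have iτ : IntegrableOn (fun x => Set.indicator {x | 1 - 6 * δ < G x} U x) Ω := iU.indicator hms
  have hUn : ∀ x, 0 ≤ U x := fun x => by positivity
  have cG : ContinuousOn (fun x => max (G x - (1 - 6 * δ)) 0) Ω := (hG.continuous.sub continuous_const).continuousOn.sup continuousOn_const
  have it : IntegrableOn (fun x => max (G x - (1 - 6 * δ)) 0 * w x ^ 2) Ω := by
    apply hI0.bdd_mul (c := 6 * δ)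
    · exact cG.aestronglyMeasurable hΩ.measurableSet
    · filter_upwards [ae_restrict_mem hΩ.measurableSet] with x hx
      rw [Real.norm_eq_abs, abs_of_nonneg (le_max_right _ _)]
      exact max_le (by linarith [hlt x hx]) (by positivity)
  have hRb : ∀ x ∈ Ω, Rf x ^ 2 ≤ CR * U x := by
    intro x hx
    rw [hRf x hx]
    obtain ⟨b1, b2, b3, b4, b5, b6⟩ := hbd x hx
    let a : ℝ := L * (‖fderiv ℝ w x‖ + ‖fderiv ℝ (fderiv ℝ w) x‖)
    have hp : ‖p‖ ≤ 1 + ‖p‖ + ‖q‖ := by linarith [norm_nonneg q]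
    have hq : ‖q‖ ≤ 1 + ‖p‖ + ‖q‖ := by linarith [norm_nonneg p]
    have h1 : 1 ≤ 1 + ‖p‖ + ‖q‖ := by linarith [norm_nonneg p, norm_nonneg q]
    have w1 : ∀ r : EuclideanSpace ℝ (Fin n), ‖r‖ ≤ 1 + ‖p‖ + ‖q‖ → |fderiv ℝ w x r| ≤ a := by
      intro r hr
      refine ((fderiv ℝ w x).le_opNorm r).trans ?_
      have : ‖r‖ ≤ L := hr.trans (by simp only [L]; nlinarith)
      have h3 : 0 ≤ L * ‖fderiv ℝ (fderiv ℝ w) x‖ := by positivity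
      have h4 : ‖fderiv ℝ w x‖ * ‖r‖ ≤ ‖fderiv ℝ w x‖ * L := by gcongr
      simp only [a]; linarith
    have w2 : ∀ r s : EuclideanSpace ℝ (Fin n), ‖r‖ ≤ 1 + ‖p‖ + ‖q‖ → ‖s‖ ≤ 1 + ‖p‖ + ‖q‖ → |dd w x r s| ≤ a := by
      intro r s hr hs
      refine (dd_le w x r s).trans ?_
      have : ‖r‖ * ‖s‖ ≤ L := by simp only [L]; rw [sq]; gcongr
      have h3 : 0 ≤ L * ‖fderiv ℝ w x‖ := by positivity
      have h4 : ‖fderiv ℝ (fderiv ℝ w) x‖ * (‖r‖ * ‖s‖) ≤ ‖fderiv ℝ (fderiv ℝ w) x‖ * L := by gcongr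
      simp only [a]; linarith
    have ha : |fderiv ℝ G x p * (dd G x q p * fderiv ℝ w x q + fderiv ℝ G x p * dd w x q q
          - dd G x q q * fderiv ℝ w x p - fderiv ℝ G x q * dd w x q p)
      - fderiv ℝ G x q * (dd G x p p * fderiv ℝ w x q + fderiv ℝ G x p * dd w x p q
          - dd G x p q * fderiv ℝ w x p - fderiv ℝ G x q * dd w x p p)| ≤ 8 * (b ^ 2 * a) := by
      have t1 := abs_le.1 (tri b1 b5 (w1 q hq))
      have t2 := abs_le.1 (tri b1 b1 (w2 q q hq hq))
      have t3 := abs_le.1 (tri b1 b6 (w1 p hp))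
      have t4 := abs_le.1 (tri b1 b2 (w2 q p hq hp))
      have t5 := abs_le.1 (tri b2 b3 (w1 q hq))
      have t6 := abs_le.1 (tri b2 b1 (w2 p q hp hq))
      have t7 := abs_le.1 (tri b2 b4 (w1 p hp))
      have t8 := abs_le.1 (tri b2 b2 (w2 p p hp hp))
      rw [abs_le]
      constructor <;> linarith [t1.1, t1.2, t2.1, t2.2, t3.1, t3.2, t4.1, t4.2, t5.1, t5.2, t6.1, t6.2, t7.1, t7.2, t8.1, t8.2]
    have ha2 : a ^ 2 ≤ L ^ 2 * (2 * U x) := by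
      simp only [a, U]; rw [mul_pow]
      gcongr
      nlinarith [sq_nonneg (‖fderiv ℝ w x‖ - ‖fderiv ℝ (fderiv ℝ w) x‖)]
    rw [← sq_abs]
    calc _ ≤ (8 * (b ^ 2 * a)) ^ 2 := by gcongr
      _ = 64 * b ^ 4 * a ^ 2 := by ring
      _ ≤ 64 * b ^ 4 * (L ^ 2 * (2 * U x)) := by gcongr
      _ = CR * U x := by simp only [CR]; ring
  have hCR : 0 ≤ CR := by positivity
  have ptw : ∀ x ∈ Ω, -(W (G x) * w x * Rf x) ≤ 1 / (6 * δ ^ 2) * (max (G x - (1 - 6 * δ)) 0 * w x ^ 2)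
      + δ / 2 * CR * Set.indicator {x | 1 - 6 * δ < G x} U x := by
    intro x hx
    have hi : 0 ≤ Set.indicator {x | 1 - 6 * δ < G x} U x := Set.indicator_nonneg (fun x _ => hUn x) x
    have hm : 0 ≤ max (G x - (1 - 6 * δ)) 0 := le_max_right _ _
    by_cases h : G x ≤ 1 - 3 * δ
    · rw [hW0' _ h]
      have : 0 ≤ 1 / (6 * δ ^ 2) * (max (G x - (1 - 6 * δ)) 0 * w x ^ 2)
        + δ / 2 * CR * Set.indicator {x | 1 - 6 * δ < G x} U x := by positivity
      linarith
    · have h := not_le.1 h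
      rw [Set.indicator_of_mem (Set.mem_ofPred.2 (by linarith))]
      have h3 : 3 * δ ≤ max (G x - (1 - 6 * δ)) 0 := le_max_of_le_left (by linarith)
      obtain ⟨u0, u1⟩ := hWb (G x)
      have y : -(w x * Rf x) ≤ 1 / (2 * δ) * w x ^ 2 + δ / 2 * Rf x ^ 2 := by
        have : 0 ≤ 1 / (2 * δ) * (w x + δ * Rf x) ^ 2 := by positivity
        have e : 1 / (2 * δ) * (w x + δ * Rf x) ^ 2 = 1 / (2 * δ) * w x ^ 2 + w x * Rf x + δ / 2 * Rf x ^ 2 := by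
          field_simp; ring
        linarith
      have z : 0 ≤ 1 / (2 * δ) * w x ^ 2 + δ / 2 * Rf x ^ 2 := by positivity
      have y2 : -(W (G x) * w x * Rf x) ≤ 1 / (2 * δ) * w x ^ 2 + δ / 2 * Rf x ^ 2 := by
        have := mul_le_mul_of_nonneg_left y u0
        nlinarith
      have y3 : 1 / (2 * δ) * w x ^ 2 = 1 / (6 * δ ^ 2) * (3 * δ * w x ^ 2) := by field_simp; ring
      have y4 : 1 / (6 * δ ^ 2) * (3 * δ * w x ^ 2) ≤ 1 / (6 * δ ^ 2) * (max (G x - (1 - 6 * δ)) 0 * w x ^ 2) := by gcongr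
      have y5 : δ / 2 * Rf x ^ 2 ≤ δ / 2 * (CR * U x) := by have := hRb x hx; gcongr
      linarith
  have step2 : ∫ x in Ω, W (G x) * (fderiv ℝ G x p * fderiv ℝ w x q - fderiv ℝ G x q * fderiv ℝ w x p) ^ 2
      ≤ 1 / (6 * δ ^ 2) * (∫ x in Ω, max (G x - (1 - 6 * δ)) 0 * w x ^ 2) + δ / 2 * CR * ∫ x in Ω, Set.indicator {x | 1 - 6 * δ < G x} U x := by
    rw [eT, ← integral_neg, ← integral_const_mul, ← integral_const_mul, ← integral_add (it.const_mul _) (iτ.const_mul _)]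
    exact setIntegral_mono_on iR.neg ((it.const_mul _).add (iτ.const_mul _)) hΩ.measurableSet ptw
  have step3 : ∫ x in Ω, max (G x - (1 - 6 * δ)) 0 ^ 3 * ‖fderiv ℝ w x‖ ^ 2 ≤ (6 * δ) ^ 3 * ∫ x in Ω, Set.indicator {x | 1 - 6 * δ < G x} U x := by
    rw [← integral_const_mul]
    apply integral_mono_of_nonneg
    · filter_upwards with x
      have hm : 0 ≤ max (G x - (1 - 6 * δ)) 0 := le_max_right _ _
      simp only [Pi.zero_apply]; positivity
    · exact iτ.const_mul _
    · filter_upwards [ae_restrict_mem hΩ.measurableSet] with x hx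
      have hm : 0 ≤ max (G x - (1 - 6 * δ)) 0 := le_max_right _ _
      by_cases h : 1 - 6 * δ < G x
      · beta_reduce
        rw [Set.indicator_of_mem (show x ∈ {x | 1 - 6 * δ < G x} from h)]
        have h1 : max (G x - (1 - 6 * δ)) 0 ≤ 6 * δ := max_le (by linarith [hlt x hx]) (by positivity)
        have h2 : ‖fderiv ℝ w x‖ ^ 2 ≤ U x := by simp only [U]; linarith [sq_nonneg ‖fderiv ℝ (fderiv ℝ w) x‖]
        gcongr
      · beta_reduce
        rw [max_eq_right (by linarith)]
        have hi : 0 ≤ Set.indicator {x | 1 - 6 * δ < G x} U x := Set.indicator_nonneg (fun x _ => hUn x) x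
        have : 0 ≤ (6 * δ) ^ 3 * Set.indicator {x | 1 - 6 * δ < G x} U x := by positivity
        simpa using this
  set Iτ := ∫ x in Ω, Set.indicator {x | 1 - 6 * δ < G x} U x with hIτ
  change _ ≤ k * (Cχ / 2 * (144 * R ^ 2 + CR / 2)) * Iτ
  refine step1.trans ?_
  have s4 : ∫ x in Ω, W (G x) * (fderiv ℝ G x p * fderiv ℝ w x q - fderiv ℝ G x q * fderiv ℝ w x p) ^ 2
      ≤ 1 / (6 * δ ^ 2) * (4 * R ^ 2 * ((6 * δ) ^ 3 * Iτ)) + δ / 2 * CR * Iτ := by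
    refine step2.trans ?_
    gcongr
    exact hst.trans (by gcongr)
  calc _ ≤ Cχ * k / (2 * δ) * (1 / (6 * δ ^ 2) * (4 * R ^ 2 * ((6 * δ) ^ 3 * Iτ)) + δ / 2 * CR * Iτ) := by gcongr
    _ = _ := by field_simp; ring

lemma core {n : ℕ} {Ω : Set (EuclideanSpace ℝ (Fin n))} (hΩ : IsOpen Ω) (hb : Bornology.IsBounded Ω)
    {w G : EuclideanSpace ℝ (Fin n) → ℝ} (hw : ContDiffOn ℝ 2 w Ω)
    (htr : ∀ x ∈ frontier Ω, Tendsto w (𝓝[Ω] x) (𝓝 0))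
    (hG : ContDiff ℝ 2 G) (hc : ConvexOn ℝ Set.univ G) (hGΩ : Ω = {x | G x < 1})
    {x0 : EuclideanSpace ℝ (Fin n)} (hx0 : G x0 = 0)
    (hI0 : IntegrableOn (fun x => w x ^ 2) Ω)
    (hI1 : IntegrableOn (fun x => ‖fderiv ℝ w x‖ ^ 2) Ω)
    (hI2 : IntegrableOn (fun x => ‖fderiv ℝ (fderiv ℝ w) x‖ ^ 2) Ω)
    (p q : EuclideanSpace ℝ (Fin n)) :
    IntegrableOn (fun x => dd w x p p * dd w x q q - dd w x p q ^ 2) Ω ∧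
    0 ≤ ∫ x in Ω, (dd w x p p * dd w x q q - dd w x p q ^ 2) := by
  obtain ⟨C, hC⟩ := core1 hΩ hb hw htr hG hc hGΩ hx0 hI0 hI1 hI2 p q
  have hlt : ∀ x ∈ Ω, G x < 1 := fun x hx => by rw [hGΩ] at hx; exact hx
  have cdet : ContinuousOn (fun x => dd w x p p * dd w x q q - dd w x p q ^ 2) Ω :=
    ((dd_cont hΩ hw p p).mul (dd_cont hΩ hw q q)).sub ((dd_cont hΩ hw p q).pow 2)
  have bdet : ∀ x, |dd w x p p * dd w x q q - dd w x p q ^ 2| ≤ (2 * (‖p‖ ^ 2 * ‖q‖ ^ 2)) * ‖fderiv ℝ (fderiv ℝ w) x‖ ^ 2 := by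
    intro x
    refine (abs_sub _ _).trans ?_
    rw [abs_mul, abs_pow]
    have h1 := dd_le w x p p
    have h2 := dd_le w x q q
    have h3 := dd_le w x p q
    calc _ ≤ (‖fderiv ℝ (fderiv ℝ w) x‖ * ‖p‖ * ‖p‖) * (‖fderiv ℝ (fderiv ℝ w) x‖ * ‖q‖ * ‖q‖) + (‖fderiv ℝ (fderiv ℝ w) x‖ * ‖p‖ * ‖q‖) ^ 2 := by gcongr
      _ = _ := by ring
  have mdet := cdet.aestronglyMeasurable (μ := volume) hΩ.measurableSet
  have iB := hI2.const_mul (2 * (‖p‖ ^ 2 * ‖q‖ ^ 2))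
  have idet : IntegrableOn (fun x => dd w x p p * dd w x q q - dd w x p q ^ 2) Ω :=
    iB.mono' mdet (by filter_upwards with x; exact bdet x)
  refine ⟨idet, ?_⟩
  have cG := hG.continuous
  have hk : ∀ k : ℝ, 0 < k → 0 ≤ ∫ x in Ω, (1 - Real.exp (-(k * (1 - G x)))) * (dd w x p p * dd w x q q - dd w x p q ^ 2) := by
    intro k hk
    have hδ : ∀ m : ℕ, 0 < 1 / 12 * (1 / ((m:ℝ) + 1)) ∧ 1 / 12 * (1 / ((m:ℝ) + 1)) ≤ 1 / 12 := by
      intro m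
      refine ⟨by positivity, ?_⟩
      have : 1 / ((m:ℝ) + 1) ≤ 1 := by rw [div_le_one (by positivity)]; linarith [Nat.cast_nonneg (α := ℝ) m]
      linarith
    have hδ0 : Tendsto (fun m : ℕ => 1 / 12 * (1 / ((m:ℝ) + 1))) atTop (𝓝 0) := by
      have h := (tendsto_one_div_add_atTop_nhds_zero_nat (𝕜 := ℝ)).const_mul (1/12)
      rw [mul_zero] at h; exact h
    choose φ hφc hφb hφe hφi using fun m : ℕ => hC k _ hk (hδ m).1 (hδ m).2
    have hev : ∀ x ∈ Ω, ∀ᶠ m : ℕ in atTop, 6 * (1 / 12 * (1 / ((m:ℝ) + 1))) < 1 - G x := by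
      intro x hx
      have : Tendsto (fun m : ℕ => 6 * (1 / 12 * (1 / ((m:ℝ) + 1)))) atTop (𝓝 0) := by
        have h := hδ0.const_mul 6
        rw [mul_zero] at h; exact h
      exact this.eventually (Iio_mem_nhds (by linarith [hlt x hx]))
    have t1 : Tendsto (fun m => - ∫ x in Ω, φ m x * (dd w x p p * dd w x q q - dd w x p q ^ 2)) atTop
        (𝓝 (- ∫ x in Ω, (1 - Real.exp (-(k * (1 - G x)))) * (dd w x p p * dd w x q q - dd w x p q ^ 2))) := by
      apply Tendsto.neg
      apply tendsto_integral_of_dominated_convergence (fun x => (2 * (‖p‖ ^ 2 * ‖q‖ ^ 2)) * ‖fderiv ℝ (fderiv ℝ w) x‖ ^ 2)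
      · intro m
        exact (hφc m).aestronglyMeasurable.mul mdet
      · exact iB
      · intro m
        filter_upwards [ae_restrict_mem hΩ.measurableSet] with x hx
        rw [Real.norm_eq_abs, abs_mul, abs_of_nonneg (hφb m x hx).1]
        have := mul_le_mul_of_nonneg_right (hφb m x hx).2 (abs_nonneg (dd w x p p * dd w x q q - dd w x p q ^ 2))
        linarith [bdet x]
      · filter_upwards [ae_restrict_mem hΩ.measurableSet] with x hx
        apply tendsto_const_nhds.congr'
        filter_upwards [hev x hx] with m hm
        rw [hφe m x (by have := (hδ m).1; linarith)]
    have t2 : Tendsto (fun m : ℕ => k * C * ∫ x in Ω, Set.indicator {x | 1 - 6 * (1 / 12 * (1 / ((m:ℝ) + 1))) < G x}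
          (fun x => ‖fderiv ℝ w x‖ ^ 2 + ‖fderiv ℝ (fderiv ℝ w) x‖ ^ 2) x) atTop (𝓝 (k * C * ∫ x in Ω, (0:ℝ))) := by
      apply Tendsto.const_mul
      apply tendsto_integral_of_dominated_convergence (fun x => ‖fderiv ℝ w x‖ ^ 2 + ‖fderiv ℝ (fderiv ℝ w) x‖ ^ 2)
      · intro m
        exact (hI1.add hI2).aestronglyMeasurable.indicator (isOpen_lt continuous_const hG.continuous).measurableSet
      · exact hI1.add hI2
      · intro m
        filter_upwards with x
        rw [Real.norm_eq_abs, abs_of_nonneg (Set.indicator_nonneg (fun x _ => by positivity) x)]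
        exact Set.indicator_le_self' (fun _ _ => by positivity) x
      · filter_upwards [ae_restrict_mem hΩ.measurableSet] with x hx
        apply tendsto_const_nhds.congr'
        filter_upwards [hev x hx] with m hm
        rw [Set.indicator_of_notMem]
        intro h
        have := Set.mem_ofPred.1 h
        linarith
    have := le_of_tendsto_of_tendsto' t1 t2 hφi
    simp at this
    exact this
  have t3 : Tendsto (fun m : ℕ => ∫ x in Ω, (1 - Real.exp (-(((m:ℝ) + 1) * (1 - G x)))) * (dd w x p p * dd w x q q - dd w x p q ^ 2)) atTop
      (𝓝 (∫ x in Ω, (dd w x p p * dd w x q q - dd w x p q ^ 2))) := by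
    apply tendsto_integral_of_dominated_convergence (fun x => (2 * (‖p‖ ^ 2 * ‖q‖ ^ 2)) * ‖fderiv ℝ (fderiv ℝ w) x‖ ^ 2)
    · intro m
      exact (by fun_prop : Continuous (fun x => 1 - Real.exp (-(((m:ℝ) + 1) * (1 - G x))))).aestronglyMeasurable.mul mdet
    · exact iB
    · intro m
      filter_upwards [ae_restrict_mem hΩ.measurableSet] with x hx
      have hd : 0 < 1 - G x := by linarith [hlt x hx]
      have p3 : Real.exp (-(((m:ℝ) + 1) * (1 - G x))) ≤ 1 := by
        rw [Real.exp_le_one_iff]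
        have : 0 ≤ ((m:ℝ) + 1) * (1 - G x) := by positivity
        linarith
      have p4 := Real.exp_pos (-(((m:ℝ) + 1) * (1 - G x)))
      rw [Real.norm_eq_abs, abs_mul, abs_of_nonneg (by linarith)]
      have := abs_nonneg (dd w x p p * dd w x q q - dd w x p q ^ 2)
      nlinarith [bdet x]
    · filter_upwards [ae_restrict_mem hΩ.measurableSet] with x hx
      have hd : 0 < 1 - G x := by linarith [hlt x hx]
      have h1 : Tendsto (fun m : ℕ => ((m:ℝ) + 1) * (1 - G x)) atTop atTop :=
        (tendsto_atTop_add_const_right _ _ tendsto_natCast_atTop_atTop).atTop_mul_const hd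
      have h2 := (Real.tendsto_exp_neg_atTop_nhds_zero.comp h1).const_sub 1
      have h3 := h2.mul_const (dd w x p p * dd w x q q - dd w x p q ^ 2)
      simpa using h3
  exact ge_of_tendsto' t3 fun m => hk _ (by positivity)
end


section
open MeasureTheory Filter Topology

lemma vsq_nonneg' {m : ℕ} (v : Fin m → ℝ) : 0 ≤ vsq v := by
  unfold vsq; positivity

lemma lam1_fact {m : ℕ} {M : Matrix (Fin m) (Fin m) ℝ} (hM : M.PosDef) :
    0 ≤ lam1 M ∧ ∃ P : Matrix (Fin m) (Fin m) ℝ, (∀ i j, M i j = ∑ k, P k i * P k j) ∧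
      ∀ v : Fin m → ℝ, lam1 M * vsq v ≤ ∑ k, (∑ i, P k i * v i) ^ 2 := by
  obtain ⟨P, hP⟩ : ∃ P : Matrix (Fin m) (Fin m) ℝ, M = star P * P := by
    open scoped MatrixOrder in
    exact CStarAlgebra.nonneg_iff_eq_star_mul_self.1 hM.posSemidef.nonneg
  have hMP : ∀ i j, M i j = ∑ k, P k i * P k j := by
    intro i j
    rw [hP, Matrix.mul_apply]
    simp [Matrix.star_apply]
  have hq : ∀ v : Fin m → ℝ, ∑ i, ∑ j, M i j * v i * v j = ∑ k, (∑ i, P k i * v i) ^ 2 := by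
    intro v
    have h1 : ∀ k, (∑ i, P k i * v i) ^ 2 = ∑ i, ∑ j, (P k i * v i) * (P k j * v j) := by
      intro k
      rw [sq, Finset.sum_mul_sum]
    simp_rw [h1, hMP, Finset.sum_mul]
    rw [Finset.sum_comm]
    have : ∀ j, ∑ i, ∑ k, P k i * P k j * v i * v j = ∑ k, ∑ i, P k i * P k j * v i * v j :=
      fun j => Finset.sum_comm
    simp_rw [this]
    rw [Finset.sum_comm]
    refine Finset.sum_congr rfl fun k _ => ?_
    rw [Finset.sum_comm]
    refine Finset.sum_congr rfl fun i _ => Finset.sum_congr rfl fun j _ => ?_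
    ring
  have hnn : ∀ x ∈ {v | ∃ a : Fin m → ℝ, vsq a = 1 ∧ v = ∑ i, ∑ j, M i j * a i * a j}, 0 ≤ x := by
    intro x hx
    obtain ⟨a, -, rfl⟩ := Set.mem_ofPred.1 hx
    rw [hq]; positivity
  have h0 : 0 ≤ lam1 M := Real.sInf_nonneg hnn
  refine ⟨h0, P, hMP, fun v => ?_⟩
  rcases (vsq_nonneg' v).eq_or_lt with h | h
  · rw [← h, mul_zero]; positivity
  have hs : 0 < Real.sqrt (vsq v) := Real.sqrt_pos.2 h
  have hs2 : Real.sqrt (vsq v) ^ 2 = vsq v := Real.sq_sqrt h.le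
  set s := Real.sqrt (vsq v) with hsd
  have h1 : lam1 M ≤ ∑ k, (∑ i, P k i * (s⁻¹ * v i)) ^ 2 := by
    refine csInf_le ⟨0, hnn⟩ (Set.mem_ofPred.2 ⟨fun i => s⁻¹ * v i, ?_, (hq _).symm⟩)
    unfold vsq
    simp_rw [mul_pow]
    rw [← Finset.mul_sum]
    change s⁻¹ ^ 2 * vsq v = 1
    rw [← hs2]; field_simp
  have h2 : ∀ k, (∑ i, P k i * (s⁻¹ * v i)) = s⁻¹ * ∑ i, P k i * v i := by
    intro k
    rw [Finset.mul_sum]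
    exact Finset.sum_congr rfl fun i _ => by ring
  simp_rw [h2, mul_pow] at h1
  rw [← Finset.mul_sum] at h1
  calc lam1 M * vsq v ≤ (s⁻¹ ^ 2 * ∑ k, (∑ i, P k i * v i) ^ 2) * vsq v := by gcongr
    _ = _ := by rw [← hs2]; field_simp

lemma alg1 {m : ℕ} {P : Matrix (Fin m) (Fin m) ℝ} {l : ℝ} (hl : 0 ≤ l)
    (hP : ∀ v : Fin m → ℝ, l * vsq v ≤ ∑ k, (∑ i, P k i * v i) ^ 2)
    (H : Fin m → Fin m → ℝ) :
    l ^ 2 * ∑ i, ∑ j, H i j ^ 2 ≤ ∑ k, ∑ r, (∑ i, ∑ j, P k i * P r j * H i j) ^ 2 := by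
  have e : ∀ k r, ∑ i, ∑ j, P k i * P r j * H i j = ∑ j, P r j * ∑ i, P k i * H i j := by
    intro k r
    rw [Finset.sum_comm]
    refine Finset.sum_congr rfl fun j _ => ?_
    rw [Finset.mul_sum]
    exact Finset.sum_congr rfl fun i _ => by ring
  simp_rw [e]
  calc l ^ 2 * ∑ i, ∑ j, H i j ^ 2 = l * ∑ j, l * vsq (fun i => H i j) := by
        rw [← Finset.mul_sum, Finset.sum_comm]; unfold vsq; ring
    _ ≤ l * ∑ j, ∑ k, (∑ i, P k i * H i j) ^ 2 := by
        gcongr with j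
        exact hP _
    _ = ∑ k, l * vsq (fun j => ∑ i, P k i * H i j) := by
        rw [Finset.sum_comm, Finset.mul_sum]; rfl
    _ ≤ _ := Finset.sum_le_sum fun k _ => hP _

lemma alg2 {m : ℕ} {P M : Matrix (Fin m) (Fin m) ℝ} (hM : ∀ i j, M i j = ∑ k, P k i * P k j)
    (H : Fin m → Fin m → ℝ) :
    ∑ k, (∑ i, ∑ j, P k i * P k j * H i j) = ∑ i, ∑ j, M i j * H i j := by
  simp_rw [hM, Finset.sum_mul]
  rw [Finset.sum_comm]
  exact Finset.sum_congr rfl fun i _ => Finset.sum_comm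

lemma alg3 {m : ℕ} (h : Fin m → Fin m → ℝ) :
    (∑ k, h k k) ^ 2 = ∑ k, ∑ r, (h k k * h r r - h k r ^ 2) + ∑ k, ∑ r, h k r ^ 2 := by
  simp_rw [Finset.sum_sub_distrib]
  rw [sq, Finset.sum_mul_sum]; ring
end


section
open MeasureTheory Filter Topology

lemma sqle {a b : ℝ} (hb : 0 ≤ b) (h : a ^ 2 ≤ b ^ 2) : a ≤ b := by
  nlinarith

lemma opn1 {n : ℕ} (L : Euc n →L[ℝ] ℝ) : ‖L‖ ^ 2 ≤ ∑ i, (L (EuclideanSpace.single i 1)) ^ 2 := by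
  have hn : 0 ≤ ∑ i, (L (EuclideanSpace.single i 1)) ^ 2 := Finset.sum_nonneg fun i _ => sq_nonneg _
  have h : ‖L‖ ≤ Real.sqrt (∑ i, (L (EuclideanSpace.single i 1)) ^ 2) := by
    refine L.opNorm_le_bound (Real.sqrt_nonneg _) fun v => ?_
    refine sqle (mul_nonneg (Real.sqrt_nonneg _) (norm_nonneg _)) ?_
    rw [mul_pow, Real.sq_sqrt hn, EuclideanSpace.real_norm_sq_eq, Real.norm_eq_abs, sq_abs, ← euc_sum L v, mul_comm]
    exact Finset.sum_mul_sq_le_sq_mul_sq _ _ _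
  calc ‖L‖ ^ 2 ≤ _ := pow_le_pow_left₀ (norm_nonneg _) h 2
    _ = _ := Real.sq_sqrt hn

lemma opn2 {n : ℕ} (T : Euc n →L[ℝ] Euc n →L[ℝ] ℝ) :
    ‖T‖ ^ 2 ≤ ∑ i, ∑ j, (T (EuclideanSpace.single i 1) (EuclideanSpace.single j 1)) ^ 2 := by
  have hn : 0 ≤ ∑ i, ∑ j, (T (EuclideanSpace.single i 1) (EuclideanSpace.single j 1)) ^ 2 :=
    Finset.sum_nonneg fun i _ => Finset.sum_nonneg fun j _ => sq_nonneg _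
  have h : ‖T‖ ≤ Real.sqrt (∑ i, ∑ j, (T (EuclideanSpace.single i 1) (EuclideanSpace.single j 1)) ^ 2) := by
    refine T.opNorm_le_bound (Real.sqrt_nonneg _) fun v => ?_
    refine sqle (mul_nonneg (Real.sqrt_nonneg _) (norm_nonneg _)) ?_
    rw [mul_pow, Real.sq_sqrt hn, EuclideanSpace.real_norm_sq_eq]
    refine (opn1 (T v)).trans ?_
    rw [Finset.sum_comm, Finset.sum_mul]
    refine Finset.sum_le_sum fun j _ => ?_
    have := euc_sum (T.flip (EuclideanSpace.single j 1)) v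
    simp only [ContinuousLinearMap.flip_apply] at this
    rw [← this, mul_comm]
    exact Finset.sum_mul_sq_le_sq_mul_sq _ _ _
  calc ‖T‖ ^ 2 ≤ _ := pow_le_pow_left₀ T.opNorm_nonneg h 2
    _ = _ := Real.sq_sqrt hn

structure SC {n : ℕ} (Ω : Set (Euc n)) (f : Euc n → ℝ) : Prop where
  cd : ContDiffOn ℝ 2 f Ω
  m0 : MemLp f 2 (volume.restrict Ω)
  m1 : ∀ i, MemLp (fun x => fderiv ℝ f x (EuclideanSpace.single i 1)) 2 (volume.restrict Ω)
  m2 : ∀ i j, MemLp (fun x => dd f x (EuclideanSpace.single i 1) (EuclideanSpace.single j 1)) 2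
    (volume.restrict Ω)
  tr : ∀ x ∈ frontier Ω, Tendsto f (𝓝[Ω] x) (𝓝 0)

lemma pder2_dd {n : ℕ} {Ω : Set (Euc n)} (hΩ : IsOpen Ω) {f : Euc n → ℝ} (hf : ContDiffOn ℝ 2 f Ω)
    {x : Euc n} (hx : x ∈ Ω) (i j : Fin n) :
    pder2 f i j x = dd f x (EuclideanSpace.single i 1) (EuclideanSpace.single j 1) :=
  dd_eq hΩ hf hx _ _

lemma SC_of {n N : ℕ} {Ω : Set (Euc n)} (hΩ : IsOpen Ω) {u : Euc n → Fin N → ℝ} (hu : IsH2H10 Ω u)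
    (a : Fin N) : SC Ω (fun x => u x a) := by
  have hcd := hu.contDiffOn a
  have a0 : AEStronglyMeasurable (fun x => u x a) (volume.restrict Ω) :=
    hcd.continuousOn.aestronglyMeasurable hΩ.measurableSet
  have a1 : ∀ i, AEStronglyMeasurable (fun x => fderiv ℝ (fun x => u x a) x (EuclideanSpace.single i 1))
      (volume.restrict Ω) := fun i =>
    (fderiv_cd1' hΩ hcd _).continuousOn.aestronglyMeasurable hΩ.measurableSet
  have a2 : ∀ i j, AEStronglyMeasurable (fun x => dd (fun x => u x a) x (EuclideanSpace.single i 1)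
      (EuclideanSpace.single j 1)) (volume.restrict Ω) := fun i j =>
    (dd_cont hΩ hcd _ _).aestronglyMeasurable hΩ.measurableSet
  refine ⟨hcd, ?_, ?_, ?_, ?_⟩
  · refine (memLp_two_iff_integrable_sq_norm a0).2 ?_
    refine Integrable.mono' hu.memL2 (a0.norm.pow 2) (Eventually.of_forall fun x => ?_)
    rw [Real.norm_of_nonneg (by positivity)]
    simp only [Real.norm_eq_abs, sq_abs]
    exact Finset.single_le_sum (f := fun i => u x i ^ 2) (fun i _ => sq_nonneg _) (Finset.mem_univ a)
  · intro i
    refine (memLp_two_iff_integrable_sq (a1 i)).2 ?_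
    refine Integrable.mono' hu.grad_memL2 ((a1 i).pow 2) (Eventually.of_forall fun x => ?_)
    rw [Real.norm_of_nonneg (sq_nonneg _)]
    refine le_trans ?_ (Finset.single_le_sum (f := fun α => ∑ i, (pder (fun y => u y α) i x) ^ 2)
      (fun i _ => by positivity) (Finset.mem_univ a))
    exact Finset.single_le_sum (f := fun i => (pder (fun y => u y a) i x) ^ 2)
      (fun i _ => by positivity) (Finset.mem_univ i)
  · intro i j
    refine (memLp_two_iff_integrable_sq (a2 i j)).2 ?_
    refine Integrable.mono' hu.hess_memL2 ((a2 i j).pow 2) ?_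
    refine ae_restrict_of_forall_mem hΩ.measurableSet fun x hx => ?_
    rw [Real.norm_of_nonneg (sq_nonneg _), ← pder2_dd hΩ hcd hx i j]
    refine le_trans ?_ (Finset.single_le_sum (f := fun α => ∑ i, ∑ j, (Hess u x α i j) ^ 2)
      (fun i _ => by positivity) (Finset.mem_univ a))
    refine le_trans ?_ (Finset.single_le_sum (f := fun i => ∑ j, (Hess u x a i j) ^ 2)
      (fun i _ => by positivity) (Finset.mem_univ i))
    exact Finset.single_le_sum (f := fun j => (Hess u x a i j) ^ 2)
      (fun i _ => by positivity) (Finset.mem_univ j)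
  · intro x hx
    exact (tendsto_pi_nhds.1 (hu.zero_trace x hx)) a

lemma fderiv_lin {n : ℕ} {Ω : Set (Euc n)} (hΩ : IsOpen Ω) {f g : Euc n → ℝ}
    (hf : ContDiffOn ℝ 1 f Ω) (hg : ContDiffOn ℝ 1 g Ω) (c : ℝ) {x : Euc n} (hx : x ∈ Ω) (q : Euc n) :
    fderiv ℝ (fun y => c * f y + g y) x q = c * fderiv ℝ f x q + fderiv ℝ g x q := by
  have df := cd1_diffAt hΩ hf hx
  have dg := cd1_diffAt hΩ hg hx
  have : fderiv ℝ (fun y => c * f y + g y) x = c • fderiv ℝ f x + fderiv ℝ g x :=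
    ((df.hasFDerivAt.const_mul c).add dg.hasFDerivAt).fderiv
  rw [this]; rfl

lemma dd_lin {n : ℕ} {Ω : Set (Euc n)} (hΩ : IsOpen Ω) {f g : Euc n → ℝ}
    (hf : ContDiffOn ℝ 2 f Ω) (hg : ContDiffOn ℝ 2 g Ω) (c : ℝ) {x : Euc n} (hx : x ∈ Ω) (p q : Euc n) :
    dd (fun y => c * f y + g y) x p q = c * dd f x p q + dd g x p q := by
  rw [← dd_eq hΩ ((contDiffOn_const.mul hf).add hg) hx, ← dd_eq hΩ hf hx, ← dd_eq hΩ hg hx]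
  have h2 : (fun y => fderiv ℝ (fun y => c * f y + g y) y q) =ᶠ[𝓝 x]
      fun y => c * fderiv ℝ f y q + fderiv ℝ g y q :=
    eventually_of_mem (hΩ.mem_nhds hx) fun y hy =>
      fderiv_lin hΩ (hf.of_le one_le_two) (hg.of_le one_le_two) c hy q
  rw [h2.fderiv_eq]
  exact fderiv_lin hΩ (fderiv_cd1' hΩ hf q) (fderiv_cd1' hΩ hg q) c hx p

lemma SC.lin1 {n : ℕ} {Ω : Set (Euc n)} (hΩ : IsOpen Ω) {f g : Euc n → ℝ}
    (hf : SC Ω f) (hg : SC Ω g) (c : ℝ) : SC Ω (fun y => c * f y + g y) := by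
  refine ⟨(contDiffOn_const.mul hf.cd).add hg.cd, (hf.m0.const_mul c).add hg.m0, ?_, ?_, ?_⟩
  · intro i
    refine MemLp.ae_eq ?_ (((hf.m1 i).const_mul c).add (hg.m1 i))
    refine ae_restrict_of_forall_mem hΩ.measurableSet fun x hx => ?_
    exact (fderiv_lin hΩ (hf.cd.of_le one_le_two) (hg.cd.of_le one_le_two) c hx _).symm
  · intro i j
    refine MemLp.ae_eq ?_ (((hf.m2 i j).const_mul c).add (hg.m2 i j))
    refine ae_restrict_of_forall_mem hΩ.measurableSet fun x hx => ?_
    exact (dd_lin hΩ hf.cd hg.cd c hx _ _).symm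
  · intro x hx
    simpa using ((hf.tr x hx).const_mul c).add (hg.tr x hx)

lemma SC.zero {n : ℕ} {Ω : Set (Euc n)} : SC Ω (fun _ => (0:ℝ)) := by
  refine ⟨contDiffOn_const, MemLp.zero, fun i => ?_, fun i j => ?_, fun x _ => tendsto_const_nhds⟩
  · have : (fun x => fderiv ℝ (fun _ : Euc n => (0:ℝ)) x (EuclideanSpace.single i 1)) = fun _ => 0 := by
      ext x; simp
    rw [this]; exact MemLp.zero
  · have : (fun x => dd (fun _ : Euc n => (0:ℝ)) x (EuclideanSpace.single i 1)
        (EuclideanSpace.single j 1)) = fun _ => 0 := by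
      have e1 : fderiv ℝ (fun _ : Euc n => (0:ℝ)) = fun _ => 0 := by ext x; simp
      ext x; unfold dd; rw [e1]; simp
    rw [this]; exact MemLp.zero

lemma SC.lin {n N : ℕ} {Ω : Set (Euc n)} (hΩ : IsOpen Ω) {f : Fin N → Euc n → ℝ}
    (hf : ∀ b, SC Ω (f b)) (c : Fin N → ℝ) :
    SC Ω (fun y => ∑ b, c b * f b y) ∧ ∀ x ∈ Ω, ∀ i j,
      pder2 (fun y => ∑ b, c b * f b y) i j x = ∑ b, c b * pder2 (f b) i j x := by
  have key : ∀ s : Finset (Fin N), SC Ω (fun y => ∑ b ∈ s, c b * f b y) ∧ ∀ x ∈ Ω, ∀ i j,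
      pder2 (fun y => ∑ b ∈ s, c b * f b y) i j x = ∑ b ∈ s, c b * pder2 (f b) i j x := by
    intro s
    induction s using Finset.induction_on with
    | empty =>
      simp only [Finset.sum_empty]
      exact ⟨SC.zero, fun x _ i j => by simp [pder2, pder]⟩
    | insert a s ha ih =>
      simp only [Finset.sum_insert ha]
      have h := (hf a).lin1 hΩ ih.1 (c a)
      refine ⟨h, fun x hx i j => ?_⟩
      rw [← ih.2 x hx i j, pder2_dd hΩ h.cd hx, pder2_dd hΩ (hf a).cd hx, pder2_dd hΩ ih.1.cd hx]
      exact dd_lin hΩ (hf a).cd ih.1.cd (c a) hx _ _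
  exact key Finset.univ
end


section
open MeasureTheory Filter Topology

lemma dd_expand {n : ℕ} (f : Euc n → ℝ) (x : Euc n) (p q : Euc n) :
    dd f x p q = ∑ i, ∑ j, p i * q j * dd f x (EuclideanSpace.single i 1) (EuclideanSpace.single j 1) := by
  unfold dd
  set T := fderiv ℝ (fderiv ℝ f) x
  have h1 := euc_sum (T.flip q) p
  simp only [ContinuousLinearMap.flip_apply] at h1
  rw [← h1]
  refine Finset.sum_congr rfl fun i _ => ?_
  rw [← euc_sum (T (EuclideanSpace.single i 1)) q, Finset.mul_sum]
  exact Finset.sum_congr rfl fun j _ => by ring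

lemma SC.hmem {n : ℕ} {Ω : Set (Euc n)} (hΩ : IsOpen Ω) {f : Euc n → ℝ} (hf : SC Ω f) (i j : Fin n) :
    MemLp (fun x => pder2 f i j x) 2 (volume.restrict Ω) :=
  MemLp.ae_eq (ae_restrict_of_forall_mem hΩ.measurableSet fun x hx => (pder2_dd hΩ hf.cd hx i j).symm)
    (hf.m2 i j)

lemma mem_lin2 {n : ℕ} {μ : Measure (Euc n)} {H : Fin n → Fin n → Euc n → ℝ}
    (hH : ∀ i j, MemLp (H i j) 2 μ) (c : Fin n → Fin n → ℝ) :
    MemLp (fun x => ∑ i, ∑ j, c i j * H i j x) 2 μ :=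
  memLp_finsetSum _ fun i _ => memLp_finsetSum _ fun j _ => (hH i j).const_mul _

lemma scalarMT {n : ℕ} {Ω : Set (Euc n)} (hΩ : IsOpen Ω) (hb : Bornology.IsBounded Ω)
    {G : Euc n → ℝ} (hG : ContDiff ℝ 2 G) (hc : ConvexOn ℝ Set.univ G) (hGΩ : Ω = {x | G x < 1})
    {x0 : Euc n} (hx0 : G x0 = 0) {f : Euc n → ℝ} (hf : SC Ω f)
    {M : Matrix (Fin n) (Fin n) ℝ} (hM : M.PosDef) :
    lam1 M ^ 2 * ∫ x in Ω, ∑ i, ∑ j, pder2 f i j x ^ 2 ≤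
      ∫ x in Ω, (∑ i, ∑ j, M i j * pder2 f i j x) ^ 2 := by
  obtain ⟨hl, P, hMP, hP⟩ := lam1_fact hM
  have a1 : AEStronglyMeasurable (fun x => ‖fderiv ℝ f x‖ ^ 2) (volume.restrict Ω) :=
    ((fderiv_cd1 hΩ hf.cd).continuousOn.norm.pow 2).aestronglyMeasurable hΩ.measurableSet
  have a2 : AEStronglyMeasurable (fun x => ‖fderiv ℝ (fderiv ℝ f) x‖ ^ 2) (volume.restrict Ω) :=
    (((fderiv_cd1 hΩ hf.cd).continuousOn_fderiv_of_isOpen hΩ le_rfl).norm.pow 2).aestronglyMeasurable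
      hΩ.measurableSet
  have hI1 : IntegrableOn (fun x => ‖fderiv ℝ f x‖ ^ 2) Ω := by
    refine Integrable.mono' (g := fun x => ∑ i, (fderiv ℝ f x (EuclideanSpace.single i 1)) ^ 2)
      (integrable_finsetSum _ fun i _ => (hf.m1 i).integrable_sq) a1 (Eventually.of_forall fun x => ?_)
    rw [Real.norm_of_nonneg (sq_nonneg _)]
    exact opn1 _
  have hI2 : IntegrableOn (fun x => ‖fderiv ℝ (fderiv ℝ f) x‖ ^ 2) Ω := by
    refine Integrable.mono' (g := fun x => ∑ i, ∑ j, (dd f x (EuclideanSpace.single i 1)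
        (EuclideanSpace.single j 1)) ^ 2)
      (integrable_finsetSum _ fun i _ => integrable_finsetSum _ fun j _ => (hf.m2 i j).integrable_sq)
      a2 (Eventually.of_forall fun x => ?_)
    rw [Real.norm_of_nonneg (sq_nonneg _)]
    exact opn2 _
  have hcore := core hΩ hb hf.cd hf.tr hG hc hGΩ hx0 hf.m0.integrable_sq hI1 hI2
  let p : Fin n → Euc n := fun k => WithLp.toLp 2 (P k)
  let h : Fin n → Fin n → Euc n → ℝ := fun k r x => ∑ i, ∑ j, P k i * P r j * pder2 f i j x
  have hh : ∀ k r, ∀ x ∈ Ω, h k r x = dd f x (p k) (p r) := by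
    intro k r x hx
    rw [dd_expand]
    exact Finset.sum_congr rfl fun i _ => Finset.sum_congr rfl fun j _ => by
      rw [pder2_dd hΩ hf.cd hx]
  have hmem : ∀ k r, MemLp (h k r) 2 (volume.restrict Ω) := fun k r =>
    mem_lin2 (fun i j => hf.hmem hΩ i j) _
  have hbr : ∀ k r, IntegrableOn (fun x => h k k x * h r r x - h k r x ^ 2) Ω ∧
      0 ≤ ∫ x in Ω, (h k k x * h r r x - h k r x ^ 2) := by
    intro k r
    have e : Set.EqOn (fun x => dd f x (p k) (p k) * dd f x (p r) (p r) - dd f x (p k) (p r) ^ 2)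
        (fun x => h k k x * h r r x - h k r x ^ 2) Ω := by
      intro x hx
      simp only [hh _ _ x hx]
    refine ⟨(hcore (p k) (p r)).1.congr_fun e hΩ.measurableSet, ?_⟩
    rw [← setIntegral_congr_fun hΩ.measurableSet e]
    exact (hcore (p k) (p r)).2
  have hsum : ∀ x, (∑ i, ∑ j, M i j * pder2 f i j x) ^ 2 =
      ∑ k, ∑ r, (h k k x * h r r x - h k r x ^ 2) + ∑ k, ∑ r, h k r x ^ 2 := by
    intro x
    rw [← alg2 hMP (fun i j => pder2 f i j x)]
    exact alg3 (fun k r => h k r x)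
  have i1 : Integrable (fun x => ∑ k, ∑ r, (h k k x * h r r x - h k r x ^ 2)) (volume.restrict Ω) :=
    integrable_finsetSum _ fun k _ => integrable_finsetSum _ fun r _ => (hbr k r).1
  have i2 : Integrable (fun x => ∑ k, ∑ r, h k r x ^ 2) (volume.restrict Ω) :=
    integrable_finsetSum _ fun k _ => integrable_finsetSum _ fun r _ => (hmem k r).integrable_sq
  simp_rw [hsum]
  rw [integral_add i1 i2]
  have n1 : 0 ≤ ∫ x in Ω, ∑ k, ∑ r, (h k k x * h r r x - h k r x ^ 2) := by
    rw [integral_finsetSum _ fun k _ => integrable_finsetSum _ fun r _ => (hbr k r).1]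
    refine Finset.sum_nonneg fun k _ => ?_
    rw [integral_finsetSum _ fun r _ => (hbr k r).1]
    exact Finset.sum_nonneg fun r _ => (hbr k r).2
  have n2 : lam1 M ^ 2 * ∫ x in Ω, ∑ i, ∑ j, pder2 f i j x ^ 2 ≤ ∫ x in Ω, ∑ k, ∑ r, h k r x ^ 2 := by
    rw [← integral_const_mul]
    refine integral_mono ?_ i2 fun x => alg1 hl hP _
    exact (integrable_finsetSum _ fun k _ => integrable_finsetSum _ fun r _ =>
      (hf.hmem hΩ k r).integrable_sq).const_mul _
  linarith
end


section
open MeasureTheory Filter Topology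

lemma orth_sum {N : ℕ} (a : Fin N → Fin N → ℝ) (h : ∀ γ δ, γ ≠ δ → ∑ α, a γ α * a δ α = 0) :
    vsq (fun α => ∑ γ, a γ α) = ∑ γ, vsq (a γ) := by
  unfold vsq
  have : ∀ α, (∑ γ, a γ α) ^ 2 = ∑ γ, ∑ δ, a γ α * a δ α := by
    intro α; rw [sq, Finset.sum_mul_sum]
  simp_rw [this]
  rw [Finset.sum_comm]
  refine Finset.sum_congr rfl fun γ _ => ?_
  rw [Finset.sum_comm, Finset.sum_eq_single γ]
  · exact Finset.sum_congr rfl fun α _ => by ring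
  · intro δ _ hd; exact h γ δ hd.symm
  · simp

lemma vsq_smul {m : ℕ} (c : ℝ) (v : Fin m → ℝ) : vsq (fun i => c * v i) = c ^ 2 * vsq v := by
  unfold vsq; simp_rw [mul_pow]; rw [Finset.mul_sum]

lemma QF_smul {n N : ℕ} (A : Fin N → Fin n → Fin N → Fin n → ℝ) (s t : ℝ) (η : Fin N → ℝ) (a : Fin n → ℝ) :
    QF A (fun i => s * η i) (fun i => t * a i) = s ^ 2 * t ^ 2 * QF A η a := by
  unfold QF; simp_rw [Finset.mul_sum]
  refine Finset.sum_congr rfl fun _ _ => Finset.sum_congr rfl fun _ _ => Finset.sum_congr rfl fun _ _ =>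
    Finset.sum_congr rfl fun _ _ => by ring

lemma vsq_pos_or {m : ℕ} (v : Fin m → ℝ) : v = 0 ∨ 0 < vsq v := by
  rcases (vsq_nonneg' v).eq_or_lt with h | h
  · left
    funext i
    have := (Finset.sum_eq_zero_iff_of_nonneg (fun i _ => sq_nonneg (v i))).1 h.symm i (Finset.mem_univ i)
    simpa using this
  · exact Or.inr h

lemma nuA_le {n N : ℕ} {A : Fin N → Fin n → Fin N → Fin n → ℝ} (hA : RankOnePos A) :
    0 ≤ nuA A ∧ ∀ η a, nuA A * vsq η * vsq a ≤ QF A η a := by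
  obtain ⟨ν, hν, hQ⟩ := hA
  have hq0 : ∀ η a, 0 ≤ QF A η a := fun η a =>
    le_trans (mul_nonneg (mul_nonneg hν.le (vsq_nonneg' _)) (vsq_nonneg' _)) (hQ η a)
  have hnn : ∀ x ∈ {v | ∃ (η : Fin N → ℝ) (a : Fin n → ℝ), vsq η = 1 ∧ vsq a = 1 ∧ v = QF A η a},
      0 ≤ x := by
    intro x hx
    obtain ⟨η, a, -, -, rfl⟩ := Set.mem_ofPred.1 hx
    exact hq0 _ _
  refine ⟨Real.sInf_nonneg hnn, fun η a => ?_⟩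
  rcases vsq_pos_or η with rfl | h1
  · simpa [vsq] using hq0 0 a
  rcases vsq_pos_or a with rfl | h2
  · simpa [vsq] using hq0 η 0
  have s1 := Real.sq_sqrt h1.le
  have s2 := Real.sq_sqrt h2.le
  have p1 := Real.sqrt_pos.2 h1
  have p2 := Real.sqrt_pos.2 h2
  set s := Real.sqrt (vsq η)
  set t := Real.sqrt (vsq a)
  have : nuA A ≤ QF A (fun i => s⁻¹ * η i) (fun i => t⁻¹ * a i) := by
    refine csInf_le ⟨0, hnn⟩ (Set.mem_ofPred.2 ⟨_, _, ?_, ?_, rfl⟩)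
    · rw [vsq_smul, ← s1]; field_simp
    · rw [vsq_smul, ← s2]; field_simp
  rw [QF_smul] at this
  calc nuA A * vsq η * vsq a ≤ (s⁻¹ ^ 2 * t⁻¹ ^ 2 * QF A η a) * vsq η * vsq a := by gcongr
    _ = _ := by rw [← s1, ← s2]; field_simp

lemma algC {n N : ℕ} {A : Fin N → Fin n → Fin N → Fin n → ℝ} {B M} (hS : SHdata A B M)
    (hA : RankOnePos A) (η : Fin N → ℝ) :
    nuA A ^ 2 * vsq η ≤ ∑ γ, lam1 (M γ) ^ 2 * vsq ((B γ).mulVec η) := by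
  obtain ⟨-, -, hdec, horth, -, -, a, ha, heig⟩ := hS
  obtain ⟨hn0, hnu⟩ := nuA_le hA
  have ha' : 0 < vsq a := (vsq_pos_or a).resolve_left ha
  let y : Fin N → ℝ := fun α => ∑ γ, lam1 (M γ) * (B γ).mulVec η α
  have hy : vsq y = ∑ γ, lam1 (M γ) ^ 2 * vsq ((B γ).mulVec η) := by
    have := orth_sum (fun γ α => lam1 (M γ) * (B γ).mulVec η α) (by
      intro γ δ hne
      have := horth γ δ hne η η
      calc _ = ∑ α, lam1 (M γ) * lam1 (M δ) * ((B γ).mulVec η α * (B δ).mulVec η α) :=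
            Finset.sum_congr rfl fun α _ => by ring
        _ = 0 := by rw [← Finset.mul_sum, this, mul_zero])
    rw [this]
    exact Finset.sum_congr rfl fun γ _ => vsq_smul _ _
  have hq : QF A η a = (∑ α, η α * y α) * vsq a := by
    have e1 : ∀ γ i, ∑ j, M γ i j * a j = lam1 (M γ) * a i := by
      intro γ i
      have := congrFun (heig γ) i
      simpa [Matrix.mulVec, dotProduct] using this
    have e2 : ∀ α i, ∑ β, ∑ j, A α i β j * η α * a i * η β * a j
        = (η α * y α) * a i ^ 2 := by
      intro α i
      calc ∑ β, ∑ j, A α i β j * η α * a i * η β * a j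
          = ∑ β, ∑ γ, ∑ j, (η α * a i * (B γ α β * η β)) * (M γ i j * a j) := by
            refine Finset.sum_congr rfl fun β _ => ?_
            rw [Finset.sum_comm]
            refine Finset.sum_congr rfl fun j _ => ?_
            rw [hdec]
            simp_rw [Finset.sum_mul]
            exact Finset.sum_congr rfl fun γ _ => by ring
        _ = ∑ β, ∑ γ, (η α * a i ^ 2) * (lam1 (M γ) * (B γ α β * η β)) := by
            refine Finset.sum_congr rfl fun β _ => Finset.sum_congr rfl fun γ _ => ?_
            rw [← Finset.mul_sum, e1]; ring
        _ = _ := by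
            rw [Finset.sum_comm]
            simp_rw [← Finset.mul_sum]
            change η α * a i ^ 2 * y α = _
            ring
    unfold QF
    simp_rw [e2]
    rw [← Finset.sum_mul_sum]; rfl
  have h1 : nuA A * vsq η ≤ ∑ α, η α * y α := by
    have := hnu η a
    rw [hq] at this
    exact le_of_mul_le_mul_right this ha'
  rw [← hy]
  rcases vsq_pos_or η with h0 | h0
  · have : vsq η = 0 := by simp [h0, vsq]
    rw [this, mul_zero]; exact vsq_nonneg' _
  have h2 : (∑ α, η α * y α) ^ 2 ≤ vsq η * vsq y := Finset.sum_mul_sq_le_sq_mul_sq _ _ _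
  have h3 : (nuA A * vsq η) ^ 2 ≤ (∑ α, η α * y α) ^ 2 :=
    pow_le_pow_left₀ (mul_nonneg hn0 h0.le) h1 2
  refine le_of_mul_le_mul_left ?_ h0
  nlinarith

lemma AC_split {n N : ℕ} {A : Fin N → Fin n → Fin N → Fin n → ℝ} {B M} (hS : SHdata A B M)
    (H : Fin N → Fin n → Fin n → ℝ) :
    vsq (AC A H) = ∑ γ, ∑ α, (∑ i, ∑ j, M γ i j * ∑ b, B γ α b * H b i j) ^ 2 := by
  obtain ⟨-, -, hdec, horth, -, -, -⟩ := hS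
  have e : ∀ γ α, ∑ i, ∑ j, M γ i j * ∑ b, B γ α b * H b i j =
      (B γ).mulVec (fun b => ∑ i, ∑ j, M γ i j * H b i j) α := by
    intro γ α
    unfold Matrix.mulVec dotProduct
    simp_rw [Finset.mul_sum]
    symm
    rw [Finset.sum_comm]
    refine Finset.sum_congr rfl fun i _ => ?_
    rw [Finset.sum_comm]
    exact Finset.sum_congr rfl fun j _ => Finset.sum_congr rfl fun b _ => by ring
  have hAC : AC A H = fun α => ∑ γ, ∑ i, ∑ j, M γ i j * ∑ b, B γ α b * H b i j := by
    funext α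
    unfold AC
    simp_rw [hdec]
    rw [Finset.sum_comm (s := Finset.univ) (t := Finset.univ)
      (f := fun γ i => ∑ j, M γ i j * ∑ b, B γ α b * H b i j)]
    refine Finset.sum_congr rfl fun i _ => ?_
    simp_rw [Finset.sum_mul, Finset.mul_sum]
    rw [Finset.sum_comm]
    have : ∀ j, ∑ b, ∑ γ, B γ α b * M γ i j * H b i j = ∑ γ, ∑ b, M γ i j * (B γ α b * H b i j) := by
      intro j
      rw [Finset.sum_comm]
      exact Finset.sum_congr rfl fun _ _ => Finset.sum_congr rfl fun _ _ => by ring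
    simp_rw [this]
    exact Finset.sum_comm
  rw [hAC]
  simp_rw [e]
  rw [orth_sum (fun γ α => (B γ).mulVec (fun b => ∑ i, ∑ j, M γ i j * H b i j) α)
    fun γ δ hne => horth γ δ hne _ _]
  rfl

lemma systemMT {n N : ℕ} {Ω : Set (Euc n)} (hΩ : IsOpen Ω) (hb : Bornology.IsBounded Ω)
    {G : Euc n → ℝ} (hG : ContDiff ℝ 2 G) (hc : ConvexOn ℝ Set.univ G) (hGΩ : Ω = {x | G x < 1})
    {x0 : Euc n} (hx0 : G x0 = 0) {w : Euc n → Fin N → ℝ} (hw : ∀ b, SC Ω (fun x => w x b))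
    {A : Fin N → Fin n → Fin N → Fin n → ℝ} {B M} (hS : SHdata A B M) (hA : RankOnePos A) :
    IntegrableOn (fun x => tsq (Hess w x)) Ω ∧ IntegrableOn (fun x => vsq (AC A (Hess w x))) Ω ∧
    nuA A ^ 2 * ∫ x in Ω, tsq (Hess w x) ≤ ∫ x in Ω, vsq (AC A (Hess w x)) := by
  have hH : ∀ b i j, MemLp (fun x => Hess w x b i j) 2 (volume.restrict Ω) :=
    fun b i j => (hw b).hmem hΩ i j
  let z : Fin N → Fin N → Euc n → ℝ := fun γ α x => ∑ b, B γ α b * w x b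
  have hz : ∀ γ α, SC Ω (z γ α) := fun γ α => (SC.lin hΩ hw (fun b => B γ α b)).1
  have hz2 : ∀ γ α, ∀ x ∈ Ω, ∀ i j, pder2 (z γ α) i j x = ∑ b, B γ α b * Hess w x b i j :=
    fun γ α => (SC.lin hΩ hw (fun b => B γ α b)).2
  have i0 : IntegrableOn (fun x => tsq (Hess w x)) Ω :=
    integrable_finsetSum _ fun b _ => integrable_finsetSum _ fun i _ => integrable_finsetSum _ fun j _ =>
      (hH b i j).integrable_sq
  have m1 : ∀ γ α, MemLp (fun x => ∑ i, ∑ j, M γ i j * pder2 (z γ α) i j x) 2 (volume.restrict Ω) :=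
    fun γ α => mem_lin2 (fun i j => (hz γ α).hmem hΩ i j) _
  have eqAC : Set.EqOn (fun x => ∑ γ, ∑ α, (∑ i, ∑ j, M γ i j * pder2 (z γ α) i j x) ^ 2)
      (fun x => vsq (AC A (Hess w x))) Ω := by
    intro x hx
    beta_reduce
    rw [AC_split hS]
    simp_rw [hz2 _ _ x hx]
  have i1 : IntegrableOn (fun x => ∑ γ, ∑ α, (∑ i, ∑ j, M γ i j * pder2 (z γ α) i j x) ^ 2) Ω :=
    integrable_finsetSum _ fun γ _ => integrable_finsetSum _ fun α _ => (m1 γ α).integrable_sq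
  refine ⟨i0, i1.congr_fun eqAC hΩ.measurableSet, ?_⟩
  rw [← setIntegral_congr_fun hΩ.measurableSet eqAC]
  have i2 : ∀ γ α, Integrable (fun x => ∑ i, ∑ j, pder2 (z γ α) i j x ^ 2) (volume.restrict Ω) :=
    fun γ α => integrable_finsetSum _ fun i _ => integrable_finsetSum _ fun j _ =>
      ((hz γ α).hmem hΩ i j).integrable_sq
  calc nuA A ^ 2 * ∫ x in Ω, tsq (Hess w x)
      ≤ ∫ x in Ω, ∑ γ, ∑ α, lam1 (M γ) ^ 2 * ∑ i, ∑ j, pder2 (z γ α) i j x ^ 2 := by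
        rw [← integral_const_mul]
        refine setIntegral_mono_on (i0.const_mul _) (integrable_finsetSum _ fun γ _ =>
          integrable_finsetSum _ fun α _ => (i2 γ α).const_mul _) hΩ.measurableSet fun x hx => ?_
        simp_rw [hz2 _ _ x hx]
        calc nuA A ^ 2 * tsq (Hess w x)
            = ∑ i, ∑ j, nuA A ^ 2 * vsq (fun b => Hess w x b i j) := by
              unfold tsq vsq
              simp_rw [Finset.mul_sum]
              rw [Finset.sum_comm]
              exact Finset.sum_congr rfl fun i _ => Finset.sum_comm
          _ ≤ ∑ i, ∑ j, ∑ γ, lam1 (M γ) ^ 2 * vsq ((B γ).mulVec (fun b => Hess w x b i j)) :=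
              Finset.sum_le_sum fun i _ => Finset.sum_le_sum fun j _ => algC hS hA _
          _ = _ := by
              unfold vsq Matrix.mulVec dotProduct
              simp_rw [Finset.mul_sum]
              have : ∀ i : Fin n, ∑ j : Fin n, ∑ γ, ∑ α, lam1 (M γ) ^ 2 * (∑ b, B γ α b * Hess w x b i j) ^ 2
                = ∑ γ, ∑ α, ∑ j : Fin n, lam1 (M γ) ^ 2 * (∑ b, B γ α b * Hess w x b i j) ^ 2 := by
                intro i
                rw [Finset.sum_comm]
                exact Finset.sum_congr rfl fun γ _ => Finset.sum_comm
              simp_rw [this]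
              rw [Finset.sum_comm]
              exact Finset.sum_congr rfl fun γ _ => Finset.sum_comm
    _ = ∑ γ, ∑ α, lam1 (M γ) ^ 2 * ∫ x in Ω, ∑ i, ∑ j, pder2 (z γ α) i j x ^ 2 := by
        rw [integral_finsetSum _ fun γ _ => integrable_finsetSum _ fun α _ => (i2 γ α).const_mul _]
        refine Finset.sum_congr rfl fun γ _ => ?_
        rw [integral_finsetSum _ fun α _ => (i2 γ α).const_mul _]
        exact Finset.sum_congr rfl fun α _ => integral_const_mul _ _
    _ ≤ ∑ γ, ∑ α, ∫ x in Ω, (∑ i, ∑ j, M γ i j * pder2 (z γ α) i j x) ^ 2 :=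
        Finset.sum_le_sum fun γ _ => Finset.sum_le_sum fun α _ =>
          scalarMT hΩ hb hG hc hGΩ hx0 (hz γ α) (hS.2.2.2.2.2.1 γ)
    _ = _ := by
        rw [integral_finsetSum _ fun γ _ => integrable_finsetSum _ fun α _ => (m1 γ α).integrable_sq]
        refine Finset.sum_congr rfl fun γ _ => ?_
        rw [integral_finsetSum _ fun α _ => (m1 γ α).integrable_sq]
end

/-- Under the K-condition with data `(𝐀, α, β, γ)` and (SH) for
`𝐀`, on an open convex bounded `C²` domain, for any `u, v ∈ (H² ∩ H¹₀)(Ω)^N`: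
`‖α(·)(F(·,D²u) − F(·,D²v)) − 𝐀:(D²u − D²v)‖_{L²(Ω)} ≤ (β+γ)‖𝐀:(D²u − D²v)‖_{L²(Ω)}`,
i.e. `u ↦ α(·)F(·,D²u)` is near `u ↦ 𝐀:D²u` with nearness constant `β+γ < 1`. -/
theorem nonlinear_operator_near_linear
    {n N : ℕ} (hn : 2 ≤ n) (hN : 2 ≤ N)
    (Ω : Set (Euc n)) (hopen : IsOpen Ω) (hconv : Convex ℝ Ω)
    (hbdd : Bornology.IsBounded Ω) (hC2 : IsC2Domain Ω)
    (F : Euc n → (Fin N → Fin n → Fin n → ℝ) → Fin N → ℝ)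
    (hCar : Caratheodory Ω F)
    (A : Fin N → Fin n → Fin N → Fin n → ℝ) (al : Euc n → ℝ) (β γ : ℝ)
    (hK : KCond Ω F A al β γ) (hSH : SH A) :
    ∀ u v : Euc n → Fin N → ℝ, IsH2H10 Ω u → IsH2H10 Ω v →
      L2V Ω (fun x => fun α =>
          al x * (F x (Hess u x) α - F x (Hess v x) α) -
            AC A (fun β' i j => Hess u x β' i j - Hess v x β' i j) α) ≤
        (β + γ) *
          L2V Ω (fun x => AC A fun β' i j => Hess u x β' i j - Hess v x β' i j) := by
  intro u v hu hv
  obtain ⟨B, M, hS⟩ := hSH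
  obtain ⟨-, hA, -, -, -, -, hβ, hγ, -, hk⟩ := hK
  obtain ⟨ρ, hρ, hΩρ, hfr⟩ := hC2
  rcases Ω.eq_empty_or_nonempty with hemp | hne
  · simp [L2V, hemp]
  obtain ⟨G, x0, hG, hc, hGΩ, hx0⟩ := exists_G hopen hconv hbdd hne ρ hρ hΩρ hfr
  let w : Euc n → Fin N → ℝ := fun x b => (-1) * v x b + u x b
  have su := SC_of hopen hu
  have sv := SC_of hopen hv
  have hw : ∀ b, SC Ω (fun x => w x b) := fun b => (sv b).lin1 hopen (su b) (-1)
  have hHw : ∀ x ∈ Ω, Hess w x = fun b i j => Hess u x b i j - Hess v x b i j := by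
    intro x hx
    funext b i j
    unfold Hess
    rw [pder2_dd hopen (hw b).cd hx, pder2_dd hopen (su b).cd hx, pder2_dd hopen (sv b).cd hx]
    rw [dd_lin hopen (sv b).cd (su b).cd (-1) hx]
    ring
  obtain ⟨i0, i1, hMT⟩ := systemMT hopen hbdd hG hc hGΩ hx0 hw hS hA
  have hsym : ∀ f : Euc n → Fin N → ℝ, (∀ b, SC Ω (fun x => f x b)) → ∀ x ∈ Ω, SymX (Hess f x) := by
    intro f hf x hx b i j
    unfold Hess
    rw [pder2_dd hopen (hf b).cd hx, pder2_dd hopen (hf b).cd hx]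
    exact dd_symm hopen (hf b).cd hx _ _
  obtain ⟨hn0, -⟩ := nuA_le hA
  have hs : (∫ x in Ω, vsq (AC A fun β' i j => Hess u x β' i j - Hess v x β' i j)) =
      ∫ x in Ω, vsq (AC A (Hess w x)) := by
    refine setIntegral_congr_fun hopen.measurableSet fun x hx => ?_
    beta_reduce
    rw [hHw x hx]
  have hint : (∫ x in Ω, vsq (fun α => al x * (F x (Hess u x) α - F x (Hess v x) α) -
            AC A (fun β' i j => Hess u x β' i j - Hess v x β' i j) α)) ≤
      ∫ x in Ω, ((β + γ) * β * nuA A ^ 2 * tsq (Hess w x) + (β + γ) * γ * vsq (AC A (Hess w x))) := by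
    refine integral_mono_of_nonneg (Eventually.of_forall fun x => vsq_nonneg' _)
      ((i0.const_mul _).add (i1.const_mul _)) ?_
    filter_upwards [hk, ae_restrict_mem hopen.measurableSet] with x hkx hx
    have h := hkx (Hess v x) (Hess w x) (hsym v sv x hx) (hsym w hw x hx)
    have hXZ : Hess v x + Hess w x = Hess u x := by
      funext b i j
      rw [hHw x hx]
      simp
    rw [hXZ] at h
    rw [← hHw x hx]
    have hflip : vsq (fun α => al x * (F x (Hess u x) α - F x (Hess v x) α) - AC A (Hess w x) α) =
        vsq (fun α => AC A (Hess w x) α - al x * (F x (Hess u x) α - F x (Hess v x) α)) := by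
      unfold vsq
      exact Finset.sum_congr rfl fun α _ => by ring
    rw [hflip]
    have ht : 0 ≤ tsq (Hess w x) := by unfold tsq; positivity
    have q1 := Real.sq_sqrt (vsq_nonneg' fun α => AC A (Hess w x) α -
      al x * (F x (Hess u x) α - F x (Hess v x) α))
    have q2 := Real.sq_sqrt ht
    have q3 := Real.sq_sqrt (vsq_nonneg' (AC A (Hess w x)))
    rw [← q1, ← q2, ← q3]
    refine (pow_le_pow_left₀ (Real.sqrt_nonneg _) h 2).trans ?_
    set a := Real.sqrt (tsq (Hess w x))
    set b := Real.sqrt (vsq (AC A (Hess w x)))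
    nlinarith [mul_nonneg (mul_pos hβ hγ).le (sq_nonneg (nuA A * a - b))]
  have hfin : (∫ x in Ω, vsq (fun α => al x * (F x (Hess u x) α - F x (Hess v x) α) -
            AC A (fun β' i j => Hess u x β' i j - Hess v x β' i j) α)) ≤
      (β + γ) ^ 2 * ∫ x in Ω, vsq (AC A (Hess w x)) := by
    refine hint.trans ?_
    rw [integral_add (i0.const_mul _) (i1.const_mul _), integral_const_mul, integral_const_mul]
    have := mul_le_mul_of_nonneg_left hMT (mul_pos (add_pos hβ hγ) hβ).le
    nlinarith
  unfold L2V
  rw [hs]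
  refine (Real.sqrt_le_sqrt hfin).trans (le_of_eq ?_)
  rw [Real.sqrt_mul (sq_nonneg _), Real.sqrt_sq (add_pos hβ hγ).le]
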